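/- arXiv:1309.3292 — 7 statements merged into one kernel-verified Lean document; each statement's English description precedes it below -/
import Mathlib

section
/- Let R be a finite Frobenius ring (a finite ring admitting a generating character: an additive character χ : (R,+) → ℂ^× such that r ↦ (x ↦ χ(rx)) is a bijection from R onto the group of additive characters of R), and let w : R → ℚ be bi-invariant with w(0) = 0. Then for all r, x ∈ R: ∑_{t ∈ R, Rt = Rr} w(tx) = |{t ∈ R : Rt = Rr}| · w(rx). Equivalently, with ε_{Rr}(t) = |{t' : Rt' = Rr}|^{-1} if Rt = Rr and ε_{Rr}(t) = 0 otherwise, the correlation w ε_{Rr} satisfies (w ε_{Rr})(x) = w(rx) for all x ∈ R. -/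
open scoped Classical

/-- A finite ring is Frobenius if it admits a generating character. -/
def IsFrobenius (R : Type) [Ring R] : Prop :=
  ∃ χ : AddChar R ℂ, ∀ ψ : AddChar R ℂ, ∃! r : R, ∀ x : R, ψ x = χ (r * x)

/-- If `a` generates the ring modulo the left ideal `L`, then a left ideal meeting the coset
`a + L` is a supplement of `L`. -/
theorem sup_eq_top_of_mem_of_sub_mem {R : Type*} [Ring R] {L J : Submodule R R} {a x : R}
    (ha : Submodule.span R {a} ⊔ L = ⊤) (hx : x ∈ J) (hxa : x - a ∈ L) : J ⊔ L = ⊤ := by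
  rw [eq_top_iff, ← ha, sup_le_iff, Submodule.span_singleton_le_iff_mem]
  refine ⟨?_, le_sup_right⟩
  have h : x - (x - a) ∈ J ⊔ L :=
    sub_mem (Submodule.mem_sup_left hx) (Submodule.mem_sup_right hxa)
  simpa using h

/-- If `a` generates the ring modulo `L`, no coset `b + L` meets a left ideal `J` in fewer elements
than `a + L` does. -/
theorem card_coset_inter_le {R : Type*} [Ring R] [Fintype R] {L : Submodule R R} {a b : R}
    (ha : Submodule.span R {a} ⊔ L = ⊤) (J : Submodule R R) :
    (Finset.univ.filter fun x : R => x - a ∈ L ∧ x ∈ J).card ≤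
      (Finset.univ.filter fun x : R => x - b ∈ L ∧ x ∈ J).card := by
  rcases (Finset.univ.filter fun x : R => x - a ∈ L ∧ x ∈ J).eq_empty_or_nonempty with
    h | ⟨x₀, hx₀⟩
  · simp [h]
  · simp only [Finset.mem_filter, Finset.mem_univ, true_and] at hx₀
    have hb : b ∈ J ⊔ L :=
      sup_eq_top_of_mem_of_sub_mem ha hx₀.2 hx₀.1 ▸ Submodule.mem_top
    obtain ⟨y, hy, z, hz, rfl⟩ := Submodule.mem_sup.mp hb
    refine Finset.card_le_card_of_injOn (fun x => x - x₀ + y) ?_ ?_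
    · intro x hx
      simp only [Finset.coe_filter, Finset.mem_univ, true_and, Set.mem_ofPred_eq] at hx ⊢
      refine ⟨?_, add_mem (sub_mem hx.2 hx₀.2) hy⟩
      have h : (x - a) - (x₀ - a) - z ∈ L := sub_mem (sub_mem hx.1 hx₀.1) hz
      convert h using 1
      abel
    · intro x _ x' _ h
      simpa using h

/-- The elements of `J` in the coset `a + L`, sorted by the left ideal they generate. -/
theorem card_coset_inter_eq_sum {R : Type*} [Ring R] [Fintype R] (L : Submodule R R) (a : R)
    (J : Submodule R R) :
    (Finset.univ.filter fun x : R => x - a ∈ L ∧ x ∈ J).card =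
      (Finset.univ.filter fun x : R => x - a ∈ L ∧ Submodule.span R {x} = J).card +
        ∑ I ∈ Finset.univ.filter (fun I : Submodule R R => I < J),
          (Finset.univ.filter fun x : R => x - a ∈ L ∧ Submodule.span R {x} = I).card := by
  have hmaps : ∀ x ∈ Finset.univ.filter (fun x : R => x - a ∈ L ∧ x ∈ J),
      Submodule.span R {x} ∈ insert J (Finset.univ.filter fun I : Submodule R R => I < J) := by
    intro x hx
    simp only [Finset.mem_filter, Finset.mem_univ, true_and] at hx
    simpa [← le_iff_eq_or_lt] using hx.2
  rw [Finset.card_eq_sum_card_fiberwise hmaps]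
  have hfiber : ∀ I ≤ J, ((Finset.univ.filter fun x : R => x - a ∈ L ∧ x ∈ J).filter
      fun x => Submodule.span R {x} = I) =
        Finset.univ.filter fun x : R => x - a ∈ L ∧ Submodule.span R {x} = I := by
    intro I hI
    ext x
    simp only [Finset.mem_filter, Finset.mem_univ, true_and]
    refine ⟨fun h => ⟨h.1.1, h.2⟩, fun h => ⟨⟨h.1, hI ?_⟩, h.2⟩⟩
    exact h.2 ▸ Submodule.mem_span_singleton_self x
  rw [Finset.sum_insert (by simp), hfiber J le_rfl]
  congr 1
  refine Finset.sum_congr rfl fun I hI => ?_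
  rw [hfiber I (Finset.mem_filter.mp hI).2.le]

/-- The number of generators of a left ideal `J` in the coset `a + L` does not depend on `a`, as
long as `a` generates the ring modulo `L`. -/
theorem card_generators_coset_eq {R : Type*} [Ring R] [Fintype R] {L : Submodule R R} {a b : R}
    (ha : Submodule.span R {a} ⊔ L = ⊤) (hb : Submodule.span R {b} ⊔ L = ⊤)
    (J : Submodule R R) :
    (Finset.univ.filter fun x : R => x - a ∈ L ∧ Submodule.span R {x} = J).card =
      (Finset.univ.filter fun x : R => x - b ∈ L ∧ Submodule.span R {x} = J).card := by
  induction J using WellFoundedLT.induction with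
  | ind J ih =>
    have h := le_antisymm (card_coset_inter_le (b := b) ha J) (card_coset_inter_le (b := a) hb J)
    rw [card_coset_inter_eq_sum, card_coset_inter_eq_sum,
      Finset.sum_congr rfl fun I hI => ih I (Finset.mem_filter.mp hI).2] at h
    exact Nat.add_right_cancel h

/-- Finite rings have stable range one: if `a` generates the ring modulo the left ideal `L`, the
coset `a + L` contains a unit. -/
theorem exists_unit_sub_mem {R : Type*} [Ring R] [Finite R] {L : Submodule R R} {a : R}
    (ha : Submodule.span R {a} ⊔ L = ⊤) : ∃ u : Rˣ, (u : R) - a ∈ L := by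
  have := Fintype.ofFinite R
  have hone : Submodule.span R {(1 : R)} = ⊤ := Ideal.span_singleton_one
  have hcard := card_generators_coset_eq ha (b := 1) (by rw [hone, top_sup_eq]) ⊤
  have hpos : 0 < (Finset.univ.filter fun x : R =>
      x - a ∈ L ∧ Submodule.span R {x} = ⊤).card := by
    rw [hcard, Finset.card_pos]
    exact ⟨1, by simp [hone]⟩
  obtain ⟨x, hx⟩ := Finset.card_pos.mp hpos
  simp only [Finset.mem_filter, Finset.mem_univ, true_and] at hx
  obtain ⟨v, hv⟩ := Submodule.mem_span_singleton.mp (hx.2 ▸ Submodule.mem_top : (1 : R) ∈ _)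
  have hvx : v * x = 1 := hv
  exact ⟨⟨x, v, mul_eq_one_symm hvx, hvx⟩, hx.1⟩

/-- In a finite ring, two generators of the same principal left ideal are left associates. -/
theorem exists_unit_mul_eq_of_span_singleton_eq {R : Type*} [Ring R] [Finite R] {r t : R}
    (h : Submodule.span R {t} = Submodule.span R {r}) : ∃ u : Rˣ, (u : R) * r = t := by
  obtain ⟨a, hta⟩ := Submodule.mem_span_singleton.mp (h ▸ Submodule.mem_span_singleton_self t)
  obtain ⟨b, hrb⟩ := Submodule.mem_span_singleton.mp (h ▸ Submodule.mem_span_singleton_self r)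
  rw [smul_eq_mul] at hta hrb
  let L : Submodule R R := LinearMap.ker (LinearMap.toSpanSingleton R R r)
  have hL : ∀ x, x ∈ L ↔ x * r = 0 := fun x => by simp [L]
  have ha : Submodule.span R {a} ⊔ L = ⊤ := by
    refine (Ideal.eq_top_iff_one (Submodule.span R {a} ⊔ L)).mpr ?_
    refine Submodule.mem_sup.mpr ⟨b * a, Submodule.mem_span_singleton.mpr ⟨b, rfl⟩, 1 - b * a, ?_,
      add_sub_cancel _ _⟩
    rw [hL, sub_mul, one_mul, mul_assoc, hta, hrb, sub_self]
  obtain ⟨u, hu⟩ := exists_unit_sub_mem ha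
  rw [hL, sub_mul, sub_eq_zero, hta] at hu
  exact ⟨u, hu⟩

/-- for a bi-invariant weight `w` with `w 0 = 0` on a finite Frobenius
ring, `∑_{t : Rt = Rr} w(tx) = |{t : Rt = Rr}| · w(rx)`; equivalently the
correlation `w ε_{Rr}` satisfies `(w ε_{Rr})(x) = w(rx)`. -/
theorem stmt2 (R : Type) [Ring R] [Fintype R] (hFrob : IsFrobenius R)
    (w : R → ℚ)
    (hbi : ∀ (u : Rˣ) (x : R), w ((u : R) * x) = w x ∧ w (x * (u : R)) = w x)
    (h0 : w 0 = 0) (r x : R) :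
    ∑ t ∈ Finset.univ.filter
        (fun t : R => Submodule.span R {t} = Submodule.span R {r}), w (t * x)
      = ((Finset.univ.filter
          (fun t : R => Submodule.span R {t} = Submodule.span R {r})).card : ℚ)
        * w (r * x) := by
  rw [Finset.sum_congr rfl (g := fun _ => w (r * x)), Finset.sum_const, nsmul_eq_mul]
  intro t ht
  obtain ⟨u, rfl⟩ := exists_unit_mul_eq_of_span_singleton_eq (Finset.mem_filter.mp ht).2
  rw [mul_assoc, (hbi u (r * x)).1]
end

section
/- Let R be a finite Frobenius ring (a finite ring admitting a generating character: an additive character χ : (R,+) → ℂ^× such that r ↦ (x ↦ χ(rx)) is a bijection from R onto the group of additive characters of R), and let w : R → ℚ be a bi-invariant weight with w(0) = 0. If the ℚ-linear map f ↦ wf, where (wf)(x) = ∑_{r ∈ R} w(rx)·f(r), from the space {f : R → ℚ : f(0) = 0 and f(ux) = f(x) for all x ∈ R, u ∈ R^×} of left-invariant functions vanishing at 0 to the space {g : R → ℚ : g(0) = 0 and g(xu) = g(x) for all x ∈ R, u ∈ R^×} of right-invariant functions vanishing at 0, is bijective, then (R, w) satisfies the Extension Property. -/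
/-- The right correlation `f ↦ wf`, `(wf)(x) = ∑_{r ∈ R} w(rx)·f(r)`. -/
def correlation (R : Type) [Ring R] [Fintype R] (w : R → ℚ) (f : R → ℚ) : R → ℚ :=
  fun x => ∑ r : R, w (r * x) * f r

/-- Left-invariant rational functions on `R` vanishing at `0`. -/
def leftInvV0 (R : Type) [Ring R] : Set (R → ℚ) :=
  {f | f 0 = 0 ∧ ∀ (u : Rˣ) (x : R), f ((u : R) * x) = f x}

/-- Right-invariant rational functions on `R` vanishing at `0`. -/
def rightInvV0 (R : Type) [Ring R] : Set (R → ℚ) :=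
  {g | g 0 = 0 ∧ ∀ (u : Rˣ) (x : R), g (x * (u : R)) = g x}

/-- The Extension Property for `(R, w)`. -/
def ExtensionProperty (R : Type) [Ring R] (w : R → ℚ) : Prop :=
  ∀ (n : ℕ) (C : Submodule R (Fin n → R)) (φ : C →ₗ[R] (Fin n → R)),
    Function.Injective φ →
    (∀ c : C, ∑ i, w (φ c i) = ∑ i, w ((c : Fin n → R) i)) →
    ∃ (π : Equiv.Perm (Fin n)) (u : Fin n → Rˣ),
      (∀ i, ∀ x : R, w (x * (u i : R)) = w x) ∧
      ∀ c : C, ∀ i, φ c i = (c : Fin n → R) (π i) * (u i : R)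

section OrbitMatching

variable {G X ι : Type*} [Group G] [MulAction G X] [Fintype G] [Fintype ι]

open Classical in
/-- The number of group elements moving `y` to `x` is the order of the stabilizer of `x` if `y`
lies in the orbit of `x`, and zero otherwise. -/
lemma card_filter_smul_eq (x y : X) :
    (Finset.univ.filter fun u : G => u • y = x).card =
      if MulAction.orbitRel G X y x then
        (Finset.univ.filter fun u : G => u • x = x).card else 0 := by
  split_ifs with h
  · obtain ⟨t, rfl⟩ := MulAction.mem_orbit_iff.1 ((MulAction.orbitRel_apply).1 h)
    refine Finset.card_equiv (Equiv.mulRight t) fun u => ?_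
    simp [mul_smul]
  · rw [Finset.card_eq_zero, Finset.filter_eq_empty_iff]
    rintro u - hu
    exact h ((MulAction.orbitRel_apply).2 ⟨u⁻¹, by simp [← hu]⟩)

open Classical in
/-- Two finite families whose `G`-translates agree as multisets are matched, up to the action
of `G`, by a permutation of the indices. -/
lemma exists_perm_smul_of_sum_card_eq (f g : ι → X)
    (h : ∀ x, ∑ i, (Finset.univ.filter fun u : G => u • f i = x).card =
      ∑ i, (Finset.univ.filter fun u : G => u • g i = x).card) :
    ∃ (σ : Equiv.Perm ι) (u : ι → G), ∀ i, f i = u i • g (σ i) := by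
  let q : X → MulAction.orbitRel.Quotient G X := Quotient.mk _
  have fiber : ∀ c, Nonempty ({i // q (f i) = c} ≃ {i // q (g i) = c}) := by
    intro c
    induction c using Quotient.inductionOn with
    | h x =>
      have hx := h x
      simp only [card_filter_smul_eq x (f _), card_filter_smul_eq x (g _)] at hx
      simp only [← Finset.sum_filter, Finset.sum_const, smul_eq_mul] at hx
      have hpos : 0 < (Finset.univ.filter fun u : G => u • x = x).card :=
        Finset.card_pos.2 ⟨1, by simp⟩
      have hcard := Nat.eq_of_mul_eq_mul_right hpos hx
      rw [← Fintype.card_eq, Fintype.card_subtype, Fintype.card_subtype]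
      convert hcard using 4 <;> exact Quotient.eq
  let e := fun c => (fiber c).some
  have key : ∀ i, ∃ u : G, f i = u • g (Equiv.ofFiberEquiv e i) := by
    intro i
    have hi : q (g (Equiv.ofFiberEquiv e i)) = q (f i) :=
      Equiv.ofFiberEquiv_map (f := fun i => q (f i)) (g := fun i => q (g i)) e i
    obtain ⟨u, hu⟩ := MulAction.mem_orbit_iff.1 ((MulAction.orbitRel_apply).1
      (Quotient.exact hi.symm))
    exact ⟨u, hu.symm⟩
  choose u hu using key
  exact ⟨_, u, hu⟩

end OrbitMatching

section GeneratingCharacter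

variable {R M : Type*} [Ring R] [Finite R] [AddCommGroup M] [Module R M] [Fintype M]

open Classical in
/-- Orthogonality for the characters obtained by composing a generating character with linear
functionals. -/
lemma sum_generating_character_comp {χ : AddChar R ℂ}
    (hχ : ∀ ψ : AddChar R ℂ, ∃ r : R, ∀ x : R, ψ x = χ (r * x)) (η : M →ₗ[R] R) :
    ∑ x, χ (η x) = if η = 0 then (Fintype.card M : ℂ) else 0 := by
  have hsum := AddChar.sum_eq_ite (χ.compAddMonoidHom η.toAddMonoidHom)
  have hzero : χ.compAddMonoidHom η.toAddMonoidHom = 0 ↔ η = 0 := by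
    refine ⟨fun h => LinearMap.ext fun x => ?_, fun h => ?_⟩
    · refine AddChar.forall_apply_eq_zero.1 fun ψ => ?_
      obtain ⟨r, hr⟩ := hχ ψ
      rw [hr, ← smul_eq_mul, ← map_smul]
      exact DFunLike.congr_fun h (r • x)
    · ext x
      simp [h]
  simpa [hzero] using hsum

end GeneratingCharacter

section Extension

variable {R : Type} [Ring R] [Fintype R] {ι : Type*} [Fintype ι]

/-- If the correlation map is surjective, two families of functionals with the same `w`-weights
have the same sums for every right-invariant rational function. -/
lemma sum_rightInvariant_eq {M : Type*} [AddCommGroup M] [Module R M] {w : R → ℚ}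
    (hsurj : Set.SurjOn (correlation R w) (leftInvV0 R) (rightInvV0 R))
    {μ ν : ι → M →ₗ[R] R} (hw : ∀ x, ∑ i, w (μ i x) = ∑ i, w (ν i x))
    {g : R → ℚ} (hg : ∀ (u : Rˣ) (y : R), g (y * u) = g y) (x : M) :
    ∑ i, g (μ i x) = ∑ i, g (ν i x) := by
  obtain ⟨f, -, hf⟩ := hsurj (show (fun y => g y - g 0) ∈ rightInvV0 R from
    ⟨sub_self _, fun u y => by simp [hg]⟩)
  have expand : ∀ κ : ι → M →ₗ[R] R,
      ∑ i, (g (κ i x) - g 0) = ∑ r, (∑ i, w (κ i (r • x))) * f r := by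
    intro κ
    simp only [Finset.sum_mul, map_smul, smul_eq_mul]
    rw [Finset.sum_comm]
    exact Finset.sum_congr rfl fun i _ => (congrFun hf (κ i x)).symm
  have h := (expand μ).trans ((Finset.sum_congr rfl fun r _ => by rw [hw]).trans (expand ν).symm)
  simpa [Finset.sum_sub_distrib] using h

/-- Over a Frobenius ring, two families of functionals with the same sums for every
right-invariant rational function agree up to a permutation and right multiplication by units. -/
lemma exists_perm_units_of_sum_rightInvariant_eq {M : Type*} [AddCommGroup M] [Module R M]
    [Finite M] (hFrob : IsFrobenius R) {μ ν : ι → M →ₗ[R] R}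
    (h : ∀ g : R → ℚ, (∀ (u : Rˣ) (y : R), g (y * u) = g y) →
      ∀ x, ∑ i, g (μ i x) = ∑ i, g (ν i x)) :
    ∃ (σ : Equiv.Perm ι) (u : ι → Rˣ), ∀ i x, μ i x = ν (σ i) x * u i := by
  classical
  have := Fintype.ofFinite M
  have : Finite (Rᵐᵒᵖ)ˣ := Finite.of_injective (fun u => (u : Rᵐᵒᵖ).unop)
    (MulOpposite.unop_injective.comp Units.val_injective)
  have : Fintype (Rᵐᵒᵖ)ˣ := Fintype.ofFinite _
  obtain ⟨χ, hχ⟩ := hFrob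
  -- sums of complex-valued invariant functions agree, by matching orbits pointwise
  have hcomplex : ∀ g : R → ℂ, (∀ (u : (Rᵐᵒᵖ)ˣ) (y : R), g (u • y) = g y) →
      ∀ x, ∑ i, g (μ i x) = ∑ i, g (ν i x) := by
    intro g hg x
    obtain ⟨σ, u, hu⟩ := exists_perm_smul_of_sum_card_eq (G := (Rᵐᵒᵖ)ˣ)
      (fun i => μ i x) (fun i => ν i x) (fun a => by
        have ha := h (fun y => ((Finset.univ.filter fun u : (Rᵐᵒᵖ)ˣ => u • y = a).card : ℚ))
          (fun v y => by
            refine congrArg _ (Finset.card_equiv (Equiv.mulRight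
              (Units.opEquiv.symm (MulOpposite.op v))) fun u => ?_)
            simp [Units.smul_def, mul_assoc]) x
        exact_mod_cast ha)
    rw [← Equiv.sum_comp σ fun i => g (ν i x)]
    exact Finset.sum_congr rfl fun i _ => by rw [hu, hg]
  have hcount : ∀ (κ : ι → M →ₗ[R] R) (η : M →ₗ[R] R),
      (Fintype.card M : ℂ) *
          ((∑ i, (Finset.univ.filter fun u : (Rᵐᵒᵖ)ˣ => u • κ i = η).card : ℕ) : ℂ) =
        ∑ x, χ (-η x) * ∑ i, ∑ u : (Rᵐᵒᵖ)ˣ, χ (u • κ i x) := by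
    intro κ η
    have horth : ∀ i (u : (Rᵐᵒᵖ)ˣ), ∑ x, χ (-η x) * χ (u • κ i x) =
        if u • κ i = η then (Fintype.card M : ℂ) else 0 := by
      intro i u
      have := sum_generating_character_comp (fun ψ => (hχ ψ).exists) (u • κ i - η)
      simp only [sub_eq_zero] at this
      rw [← this]
      refine Finset.sum_congr rfl fun x _ => ?_
      rw [← AddChar.map_add_eq_mul, LinearMap.sub_apply, LinearMap.smul_apply, sub_eq_neg_add]
    simp only [Finset.mul_sum]
    rw [Finset.sum_comm]
    simp only [Finset.sum_comm (s := (Finset.univ : Finset M)), horth]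
    simp [Finset.mul_sum, ← Finset.sum_filter, mul_comm]
  obtain ⟨σ, u, hu⟩ := exists_perm_smul_of_sum_card_eq (G := (Rᵐᵒᵖ)ˣ) μ ν (fun η => by
    have hinv := hcomplex (fun y => ∑ u : (Rᵐᵒᵖ)ˣ, χ (u • y)) (fun v y => by
      simpa [mul_smul] using Equiv.sum_comp (Equiv.mulRight v) fun u : (Rᵐᵒᵖ)ˣ => χ (u • y))
    have hη := (hcount μ η).trans ((Finset.sum_congr rfl fun x _ => by
      rw [hinv x]).trans (hcount ν η).symm)
    convert Nat.cast_injective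
      (mul_left_cancel₀ (Nat.cast_ne_zero.2 Fintype.card_ne_zero) hη))
  exact ⟨σ, fun i => (Units.opEquiv (u i)).unop, fun i x => by
    rw [hu]; simp [Units.smul_def]⟩

end Extension

/-- if the correlation map `f ↦ wf` is a bijection from the
left-invariant functions vanishing at `0` onto the right-invariant functions
vanishing at `0`, then the bi-invariant weight `w` satisfies the Extension
Property. -/
theorem stmt3 (R : Type) [Ring R] [Fintype R] (hFrob : IsFrobenius R)
    (w : R → ℚ)
    (hbi : ∀ (u : Rˣ) (x : R), w ((u : R) * x) = w x ∧ w (x * (u : R)) = w x)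
    (h0 : w 0 = 0)
    (hbij : Set.BijOn (correlation R w) (leftInvV0 R) (rightInvV0 R)) :
    ExtensionProperty R w := by
  intro n C φ _ hφ
  obtain ⟨σ, u, hu⟩ := exists_perm_units_of_sum_rightInvariant_eq hFrob
    (μ := fun i : Fin n => LinearMap.proj i ∘ₗ φ)
    (ν := fun i : Fin n => LinearMap.proj i ∘ₗ C.subtype)
    (fun _ hg => sum_rightInvariant_eq hbij.surjOn hφ hg)
  exact ⟨σ, u, fun i x => (hbi (u i) x).2, fun c i => hu i c⟩
end

section
/- Let R be a finite Frobenius ring (a finite ring admitting a generating character: an additive character χ : (R,+) → ℂ^× such that r ↦ (x ↦ χ(rx)) is a bijection from R onto the group of additive characters of R), and let w : R → ℚ be a bi-invariant weight with w(0) = 0. Then (R, w) satisfies the Extension Property if and only if the ℚ-linear map f ↦ wf, where (wf)(x) = ∑_{r ∈ R} w(rx)·f(r), from {f : R → ℚ : f(0) = 0, f(ux) = f(x) for all x ∈ R, u ∈ R^×} to {g : R → ℚ : g(0) = 0, g(xu) = g(x) for all x ∈ R, u ∈ R^×}, is bijective (equivalently, the orthogonality matrix of w is invertible). -/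
open Finset MulOpposite

section GroupActions

/-- The functions on `X` with values in `K` that are constant on the orbits of `G`. -/
def invariantFunctions (K G X : Type*) [Field K] [Group G] [MulAction G X] :
    Submodule K (X → K) where
  carrier := {f | ∀ (g : G) (x : X), f (g • x) = f x}
  add_mem' hf hg u x := by simp [hf u x, hg u x]
  zero_mem' _ _ := rfl
  smul_mem' c f hf u x := by simp [hf u x]

theorem finrank_invariantFunctions (K G X : Type*) [Field K] [Group G] [MulAction G X] [Finite X] :
    Module.finrank K (invariantFunctions K G X) = Nat.card (MulAction.orbitRel.Quotient G X) := by
  classical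
  have := Fintype.ofFinite (MulAction.orbitRel.Quotient G X)
  let e : (MulAction.orbitRel.Quotient G X → K) →ₗ[K] invariantFunctions K G X :=
    { toFun := fun F => ⟨fun x => F (Quotient.mk _ x), fun g x =>
        congrArg F (Quotient.sound (MulAction.orbitRel_apply.2 (MulAction.mem_orbit x g)))⟩
      map_add' := fun _ _ => rfl
      map_smul' := fun _ _ => rfl }
  have he : Function.Bijective e := by
    constructor
    · intro F F' h
      funext q
      induction q using Quotient.inductionOn with
      | h x => exact congrFun (congrArg Subtype.val h) x
    · rintro ⟨f, hf⟩
      refine ⟨fun q => Quotient.liftOn q f ?_, rfl⟩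
      rintro a b ⟨g, rfl⟩
      exact hf g b
  rw [← (LinearEquiv.ofBijective e he).finrank_eq, Module.finrank_fintype_fun_eq_card,
    Nat.card_eq_fintype_card]

theorem exists_perm_comp_eq_of_card_fiber_eq {ι Q : Type*} [Fintype ι] [DecidableEq Q]
    (f g : ι → Q)
    (h : ∀ q, #{i | f i = q} = #{i | g i = q}) : ∃ π : Equiv.Perm ι, ∀ i, f (π i) = g i := by
  have e : ∀ q, Nonempty ({i // g i = q} ≃ {i // f i = q}) := fun q =>
    ⟨Fintype.equivOfCardEq (by simp [Fintype.card_subtype, h])⟩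
  replace e := fun q => (e q).some
  refine ⟨(Equiv.sigmaFiberEquiv g).symm.trans
    ((Equiv.sigmaCongrRight e).trans (Equiv.sigmaFiberEquiv f)), fun i => ?_⟩
  exact (e (g i) ⟨i, rfl⟩).2

/-- Families in a `G`-set whose `G`-translates agree with multiplicity agree up to a permutation
and the action of `G`. -/
theorem exists_perm_smul_eq_of_card_eq {G X ι : Type*} [Group G] [Fintype G] [MulAction G X]
    [Fintype X] [DecidableEq X] [Fintype ι] (a b : ι → X)
    (h : ∀ x, #{p : ι × G | p.2 • a p.1 = x} = #{p : ι × G | p.2 • b p.1 = x}) :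
    ∃ (π : Equiv.Perm ι) (u : ι → G), ∀ i, b i = u i • a (π i) := by
  classical
  let mk : X → MulAction.orbitRel.Quotient G X := Quotient.mk _
  have mk_smul : ∀ (g : G) x, mk (g • x) = mk x := fun g x =>
    Quotient.sound (MulAction.orbitRel_apply.2 (MulAction.mem_orbit x g))
  have key : ∀ (c : ι → X) q, #{i | mk (c i) = q} * Fintype.card G
      = ∑ x with mk x = q, #{p : ι × G | p.2 • c p.1 = x} := by
    intro c q
    have h₁ : ({p : ι × G | mk (p.2 • c p.1) = q} : Finset (ι × G))
        = ({i | mk (c i) = q} : Finset ι) ×ˢ univ := by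
      ext p; simp [mk_smul]
    rw [← card_univ, ← card_product, ← h₁]
    rw [card_eq_sum_card_fiberwise (f := fun p : ι × G => p.2 • c p.1)
      (t := ({x | mk x = q} : Finset X)) (by intro p hp; simpa using hp)]
    refine sum_congr rfl fun x hx => ?_
    congr 1
    ext p
    simp only [mem_filter, mem_univ, true_and] at hx ⊢
    constructor
    · exact fun hp => hp.2
    · rintro rfl; exact ⟨hx, rfl⟩
  obtain ⟨π, hπ⟩ := exists_perm_comp_eq_of_card_fiber_eq (fun i => mk (a i)) (fun i => mk (b i))
    fun q => Nat.eq_of_mul_eq_mul_right (Fintype.card_pos (α := G)) <| by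
      rw [key, key]; exact sum_congr rfl fun x _ => h x
  have hu : ∀ i, ∃ u : G, b i = u • a (π i) := fun i => by
    obtain ⟨u, hu⟩ := MulAction.orbitRel_apply.1 (Quotient.exact (hπ i).symm)
    exact ⟨u, hu.symm⟩
  choose u hu using hu
  exact ⟨π, u, hu⟩

end GroupActions

/-- If a matrix and its transpose interchange two subspaces, the transpose is injective and the
dimensions compare, then the matrix is a bijection between the subspaces. -/
theorem Matrix.bijOn_mulVec_of_vecMul_injOn {X Y : Type*} [Fintype X] [Fintype Y]
    (M : Matrix Y X ℚ) (A : Submodule ℚ (X → ℚ)) (B : Submodule ℚ (Y → ℚ))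
    (hAB : ∀ f ∈ A, M.mulVec f ∈ B) (hBA : ∀ g ∈ B, M.vecMul g ∈ A)
    (hinj : ∀ g ∈ B, M.vecMul g = 0 → g = 0) (hdim : Module.finrank ℚ A ≤ Module.finrank ℚ B) :
    Set.BijOn M.mulVec A B := by
  let D : A →ₗ[ℚ] B := M.mulVecLin.restrict hAB
  let E : B →ₗ[ℚ] A := M.vecMulLinear.restrict hBA
  have hDE : Function.Injective (D ∘ₗ E) := by
    rw [← LinearMap.ker_eq_bot, LinearMap.ker_eq_bot']
    rintro ⟨g, hg⟩ h
    have h₁ : M.mulVec (M.vecMul g) = 0 := congrArg Subtype.val h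
    have h₂ : M.vecMul g ⬝ᵥ M.vecMul g = 0 := by
      rw [← Matrix.dotProduct_mulVec, h₁, dotProduct_zero]
    exact Subtype.ext (hinj g hg (dotProduct_self_eq_zero.1 h₂))
  have hD : Function.Surjective D :=
    Function.Surjective.of_comp (g := E) (LinearMap.injective_iff_surjective.1 hDE)
  have hD' : Function.Injective D :=
    (LinearMap.injective_iff_surjective_of_finrank_eq_finrank
      (le_antisymm hdim (LinearMap.finrank_le_finrank_of_surjective hD))).2 hD
  refine ⟨hAB, fun f hf f' hf' h => ?_, fun g hg => ?_⟩
  · exact congrArg Subtype.val (@hD' ⟨f, hf⟩ ⟨f', hf'⟩ (Subtype.ext h))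
  · obtain ⟨⟨f, hf⟩, h⟩ := hD ⟨g, hg⟩
    exact ⟨f, hf, congrArg Subtype.val h⟩

theorem exists_fun_sum_eq {R : Type*} [Fintype R] (a : R → ℕ) (n : ℕ) (h : ∑ r, a r = n) :
    ∃ α : Fin n → R, (∀ r, a r ≠ 0 → ∃ i, α i = r) ∧
      ∀ F : R → ℚ, ∑ i, F (α i) = ∑ r, (a r : ℚ) * F r := by
  let e : Fin n ≃ Σ r, Fin (a r) := Fintype.equivOfCardEq (by simp [h])
  refine ⟨fun i => (e i).1, fun r hr => ⟨e.symm ⟨r, ⟨0, Nat.pos_of_ne_zero hr⟩⟩, by simp⟩,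
    fun F => ?_⟩
  rw [Equiv.sum_comp e (fun p => F p.1), Fintype.sum_sigma]
  simp

theorem exists_natCast_sub_natCast_eq {R : Type*} [Fintype R] (g : R → ℚ) :
    ∃ (N : ℕ) (a b : R → ℕ), N ≠ 0 ∧ ∀ r, (a r : ℚ) - b r = N * g r := by
  classical
  have hz : ∀ r, ∃ z : ℤ, (z : ℚ) = (∏ s, (g s).den : ℕ) * g r := fun r => by
    refine ⟨(∏ s ∈ univ.erase r, (g s).den : ℕ) * (g r).num, ?_⟩
    rw [← mul_prod_erase univ _ (mem_univ r)]
    push_cast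
    rw [mul_comm ((g r).den : ℚ), mul_assoc, Rat.den_mul_eq_num]
  choose z hz using hz
  refine ⟨∏ s, (g s).den, fun r => (z r).toNat, fun r => (-z r).toNat,
    prod_ne_zero_iff.2 fun r _ => (g r).den_nz, fun r => ?_⟩
  rw [← hz]
  exact_mod_cast congrArg (Int.cast : ℤ → ℚ) (Int.toNat_sub_toNat_neg (z r))

section Extension

variable {R : Type} [Ring R]

theorem mem_invariantFunctions_op_iff {f : R → ℚ} :
    f ∈ invariantFunctions ℚ (Rᵐᵒᵖ)ˣ R ↔ ∀ (u : Rˣ) (x : R), f (x * (u : R)) = f x := by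
  refine ⟨fun h u x => ?_, fun h u x => ?_⟩
  · simpa [Units.smul_def] using h (Units.opEquiv.symm (op u)) x
  · simpa [Units.smul_def] using h (Units.opEquiv u).unop x

theorem mem_invariantFunctions_iff {f : R → ℚ} :
    f ∈ invariantFunctions ℚ Rˣ R ↔ ∀ (u : Rˣ) (x : R), f ((u : R) * x) = f x :=
  Iff.rfl

theorem eq_zero_of_forall_generating_eq_one [Finite R] {χ : AddChar R ℂ}
    (hχ : ∀ ψ : AddChar R ℂ, ∃! r : R, ∀ x : R, ψ x = χ (r * x))
    {x : R} (hx : ∀ r, χ (r * x) = 1) : x = 0 := by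
  by_contra hne
  obtain ⟨ψ, hψ⟩ := AddChar.exists_apply_ne_zero.2 hne
  obtain ⟨r, hr, -⟩ := hχ ψ
  exact hψ (by rw [hr, hx])

variable [Fintype R]

theorem finrank_leftInvariant_le (hFrob : IsFrobenius R) :
    Module.finrank ℚ (invariantFunctions ℚ Rˣ R)
      ≤ Module.finrank ℚ (invariantFunctions ℚ (Rᵐᵒᵖ)ˣ R) := by
  obtain ⟨χ, hχ⟩ := hFrob
  have hC : Module.finrank ℂ (invariantFunctions ℂ Rˣ R)
      ≤ Module.finrank ℂ (invariantFunctions ℂ (Rᵐᵒᵖ)ˣ R) := by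
    let M : Matrix R R ℂ := Matrix.of fun x r => χ (x * r)
    have hM : ∀ f ∈ invariantFunctions ℂ Rˣ R,
        M.mulVecLin f ∈ invariantFunctions ℂ (Rᵐᵒᵖ)ˣ R := by
      intro f hf u x
      simp only [Matrix.mulVecLin_apply, Matrix.mulVec, dotProduct, M, Matrix.of_apply]
      refine Fintype.sum_equiv (MulAction.toPerm (Units.opEquiv u).unop) _ _ fun r => ?_
      have := hf (Units.opEquiv u).unop r
      simp only [MulAction.toPerm_apply, this]
      simp [Units.smul_def, mul_assoc]
    refine LinearMap.finrank_le_finrank_of_injective (f := M.mulVecLin.restrict hM) ?_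
    rw [← LinearMap.ker_eq_bot, LinearMap.ker_eq_bot']
    rintro ⟨f, hf⟩ h
    have h₁ : ∀ x, ∑ r, χ (x * r) * f r = 0 := fun x => congrFun (congrArg Subtype.val h) x
    let ψ : R → AddChar R ℂ := fun r => χ.compAddMonoidHom (AddMonoidHom.mulRight r)
    have hψ : Function.Injective ψ := by
      intro r s hrs
      refine sub_eq_zero.1 (eq_zero_of_forall_generating_eq_one hχ fun x => ?_)
      have := DFunLike.congr_fun hrs x
      simp only [ψ, AddChar.compAddMonoidHom_apply, AddMonoidHom.coe_mulRight] at this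
      rw [mul_sub, AddChar.map_sub_eq_div, this, div_self (χ.val_isUnit _).ne_zero]
    have hli := (AddChar.linearIndependent R ℂ).comp ψ hψ
    refine Subtype.ext (funext fun r => Fintype.linearIndependent_iff.1 hli f ?_ r)
    funext x
    simpa [ψ, mul_comm] using h₁ x
  simpa only [finrank_invariantFunctions] using hC

variable {w : R → ℚ}

/-- Under the Extension Property the transposed correlation is injective. -/
theorem ExtensionProperty.eq_zero_of_sum_eq_zero (hE : ExtensionProperty R w) (h0 : w 0 = 0)
    {g : R → ℚ} (hg : g ∈ rightInvV0 R) (hw : ∀ x, ∑ s, w (x * s) * g s = 0) : g = 0 := by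
  classical
  obtain ⟨N, a, b, hN, hab⟩ := exists_natCast_sub_natCast_eq g
  let a' : R → ℕ := fun r => a r + ((if r = 1 then 1 else 0) + if r = 0 then ∑ s, b s else 0)
  let b' : R → ℕ := fun r => b r + ((if r = 1 then 1 else 0) + if r = 0 then ∑ s, a s else 0)
  obtain ⟨α, hα₁, hα⟩ := exists_fun_sum_eq a' (∑ r, a r + (1 + ∑ r, b r))
    (by simp [a', sum_add_distrib])
  obtain ⟨β, hβ₁, hβ⟩ := exists_fun_sum_eq b' (∑ r, a r + (1 + ∑ r, b r))
    (by simp only [b', sum_add_distrib, sum_ite_eq', mem_univ, if_true]; ring)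
  have hdiff : ∀ F : R → ℚ, F 0 = 0 → ∑ i, F (α i) - ∑ i, F (β i) = N * ∑ r, F r * g r := by
    intro F hF
    rw [hα, hβ, ← sum_sub_distrib, mul_sum]
    refine sum_congr rfl fun r _ => ?_
    by_cases hr : r = 0
    · subst hr; simp [hF]
    · have := hab r
      simp only [a', b', hr, if_false]
      push_cast
      linear_combination F r * this
  let L (γ : Fin (∑ r, a r + (1 + ∑ r, b r)) → R) : R →ₗ[R] (Fin _ → R) :=
    LinearMap.pi fun i => LinearMap.toSpanSingleton R R (γ i)
  have hL : ∀ γ, (∃ i, γ i = 1) → Function.Injective (L γ) := by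
    rintro γ ⟨i, hi⟩ x y hxy
    simpa [L, hi] using congrFun hxy i
  have hαi := hL α (hα₁ 1 (by simp [a']))
  have hβi := hL β (hβ₁ 1 (by simp [b']))
  let e := LinearEquiv.ofInjective (L α) hαi
  obtain ⟨π, u, -, hu⟩ := hE _ (LinearMap.range (L α)) (L β ∘ₗ e.symm.toLinearMap)
    (hβi.comp e.symm.injective) (by
      intro c
      obtain ⟨x, rfl⟩ := e.surjective c
      have := hdiff (fun s => w (x * s)) (by simp [h0])
      rw [hw, mul_zero] at this
      simpa [L, e] using (sub_eq_zero.1 this).symm)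
  have hαβ : ∀ i, β i = α (π i) * u i := fun i => by simpa [L, e] using hu (e 1) i
  have hsum : ∑ i, g (β i) = ∑ i, g (α i) := by
    rw [← Equiv.sum_comp π fun i => g (α i)]
    exact sum_congr rfl fun i _ => by rw [hαβ, hg.2]
  have hgg := hdiff g hg.1
  rw [hsum, sub_self, eq_comm, mul_eq_zero, or_iff_right (Nat.cast_ne_zero.2 hN)] at hgg
  exact dotProduct_self_eq_zero.1 hgg

theorem ExtensionProperty.bijOn_correlation (hE : ExtensionProperty R w) (hFrob : IsFrobenius R)
    (hbi : ∀ (u : Rˣ) (x : R), w ((u : R) * x) = w x ∧ w (x * (u : R)) = w x) (h0 : w 0 = 0) :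
    Set.BijOn (correlation R w) (leftInvV0 R) (rightInvV0 R) := by
  classical
  let M : Matrix R R ℚ := Matrix.of fun x r => w (r * x) + if x = 0 ∧ r = 0 then 1 else 0
  have hMv : ∀ f x, M.mulVec f x = correlation R w f x + if x = 0 then f 0 else 0 := by
    intro f x
    simp only [M, Matrix.mulVec, dotProduct, correlation, Matrix.of_apply, add_mul,
      sum_add_distrib, ite_and]
    split_ifs <;> simp
  have hvM : ∀ g r, M.vecMul g r = ∑ s, w (r * s) * g s + if r = 0 then g 0 else 0 := by
    intro g r
    simp only [M, Matrix.vecMul, dotProduct, Matrix.of_apply, mul_add,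
      sum_add_distrib, ite_and]
    split_ifs <;> simp [*, mul_comm]
  have hcorr0 : ∀ f, correlation R w f 0 = 0 := fun f => by simp [correlation, h0]
  have hcorr : ∀ f (u : Rˣ) x, correlation R w f (x * u) = correlation R w f x := fun f u x => by
    simp [correlation, ← mul_assoc, (hbi _ _).2]
  have key := M.bijOn_mulVec_of_vecMul_injOn (invariantFunctions ℚ Rˣ R)
    (invariantFunctions ℚ (Rᵐᵒᵖ)ˣ R)
    (fun f _ => mem_invariantFunctions_op_iff.2 fun u x => by simp [hMv, hcorr])
    (fun g _ => mem_invariantFunctions_iff.2 fun u x => by simp [hvM, mul_assoc, (hbi _ _).1])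
    (fun g hg h => by
      rw [mem_invariantFunctions_op_iff] at hg
      have hg0 : g 0 = 0 := by simpa [hvM, h0] using congrFun h 0
      exact hE.eq_zero_of_sum_eq_zero h0 ⟨hg0, hg⟩ fun x => by
        simpa [hvM, hg0] using congrFun h x)
    (finrank_leftInvariant_le hFrob)
  have hMcorr : ∀ f, f 0 = 0 → M.mulVec f = correlation R w f := fun f hf => by
    funext x; simp [hMv, hf]
  refine ⟨fun f _ => ⟨hcorr0 f, hcorr f⟩, fun f hf f' hf' h => ?_, fun g hg => ?_⟩
  · exact key.injOn (mem_invariantFunctions_iff.2 hf.2) (mem_invariantFunctions_iff.2 hf'.2)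
      (by rw [hMcorr f hf.1, hMcorr f' hf'.1, h])
  · obtain ⟨f, hf, rfl⟩ := key.surjOn (mem_invariantFunctions_op_iff.2 hg.2)
    have hf0 : f 0 = 0 := by simpa [hMv, hcorr0] using hg.1
    exact ⟨f, ⟨hf0, hf⟩, (hMcorr f hf0).symm⟩

/-- Linear functionals whose values agree up to the right action of the units, counted with
multiplicity, agree up to a permutation and right multiplication by units. -/
theorem exists_perm_smul_eq_of_sum_eq (hFrob : IsFrobenius R) {V ι : Type*} [AddCommGroup V]
    [Module R V] [Finite V] [Fintype ι] (a b : ι → V →ₗ[R] R)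
    (h : ∀ g ∈ invariantFunctions ℚ (Rᵐᵒᵖ)ˣ R, ∀ v, ∑ i, g (b i v) = ∑ i, g (a i v)) :
    ∃ (π : Equiv.Perm ι) (u : ι → (Rᵐᵒᵖ)ˣ), ∀ i, b i = u i • a (π i) := by
  classical
  obtain ⟨χ, hχ⟩ := hFrob
  have := Fintype.ofFinite V
  have : Finite (Rᵐᵒᵖ)ˣ :=
    Finite.of_injective (fun u => unop (u : Rᵐᵒᵖ)) (unop_injective.comp Units.val_injective)
  have := Fintype.ofFinite (Rᵐᵒᵖ)ˣ
  have : Finite (V →ₗ[R] R) := Finite.of_injective _ DFunLike.coe_injective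
  have := Fintype.ofFinite (V →ₗ[R] R)
  have hχsum : ∀ v, ∑ i, ∑ u : (Rᵐᵒᵖ)ˣ, χ (u • b i v) = ∑ i, ∑ u : (Rᵐᵒᵖ)ˣ, χ (u • a i v) := by
    intro v
    have hk : ∀ y : R, ∑ u : (Rᵐᵒᵖ)ˣ, χ (u • y)
        = ∑ r, χ r * ((#{u : (Rᵐᵒᵖ)ˣ | u • y = r} : ℚ) : ℂ) := by
      intro y
      rw [← sum_fiberwise univ (fun u : (Rᵐᵒᵖ)ˣ => u • y)]
      refine sum_congr rfl fun r _ => ?_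
      rw [sum_congr rfl (g := fun _ => χ r) (by simp +contextual)]
      simp [mul_comm]
    simp only [hk]
    rw [sum_comm, sum_comm (s := univ (α := ι))]
    refine sum_congr rfl fun r _ => ?_
    rw [← mul_sum, ← mul_sum, ← Rat.cast_sum, ← Rat.cast_sum,
      h (fun y => (#{u : (Rᵐᵒᵖ)ˣ | u • y = r} : ℚ)) _ v]
    intro s y
    refine congrArg _ (card_equiv (Equiv.mulRight s) fun u => ?_)
    simp [mul_smul]
  have hcount : ∀ (c : ι → V →ₗ[R] R) (ν : V →ₗ[R] R),
      (#{p : ι × (Rᵐᵒᵖ)ˣ | p.2 • c p.1 = ν} : ℂ) * Fintype.card V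
        = ∑ v, (∑ i, ∑ u : (Rᵐᵒᵖ)ˣ, χ (u • c i v)) * χ (-ν v) := by
    intro c ν
    have horth : ∀ θ : V →ₗ[R] R,
        ∑ v, χ (θ v - ν v) = if θ = ν then (Fintype.card V : ℂ) else 0 := by
      intro θ
      have := AddChar.sum_eq_ite (χ.compAddMonoidHom (θ - ν).toAddMonoidHom)
      simp only [AddChar.compAddMonoidHom_apply, LinearMap.toAddMonoidHom_coe,
        LinearMap.sub_apply] at this
      rw [this]
      refine if_congr ⟨fun hz => ?_, fun hz => ?_⟩ rfl rfl
      · ext v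
        refine sub_eq_zero.1 (eq_zero_of_forall_generating_eq_one hχ fun r => ?_)
        simpa using DFunLike.congr_fun hz (r • v)
      · ext v; simp [hz]
    simp only [sum_mul, ← AddChar.map_add_eq_mul, ← sub_eq_add_neg]
    rw [sum_comm, card_filter, Fintype.sum_prod_type]
    push_cast
    rw [sum_mul]
    refine sum_congr rfl fun i _ => ?_
    rw [sum_comm, sum_mul]
    refine sum_congr rfl fun u _ => ?_
    have := horth (u • c i)
    simp only [LinearMap.smul_apply] at this
    rw [this]
    simp
  refine exists_perm_smul_eq_of_card_eq a b fun ν => ?_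
  have hV : (Fintype.card V : ℂ) ≠ 0 := Nat.cast_ne_zero.2 Fintype.card_ne_zero
  have := (hcount a ν).trans ((by simp only [hχsum]) : _ = _) |>.trans (hcount b ν).symm
  exact_mod_cast mul_right_cancel₀ hV this

theorem extensionProperty_of_surjOn (hFrob : IsFrobenius R)
    (hbi : ∀ (u : Rˣ) (x : R), w ((u : R) * x) = w x ∧ w (x * (u : R)) = w x)
    (hsurj : Set.SurjOn (correlation R w) (leftInvV0 R) (rightInvV0 R)) :
    ExtensionProperty R w := by
  intro n C φ _ hφ
  have hinv : ∀ g ∈ invariantFunctions ℚ (Rᵐᵒᵖ)ˣ R, ∀ c : C,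
      ∑ i, g (φ c i) = ∑ i, g ((c : Fin n → R) i) := by
    intro g hg c
    rw [mem_invariantFunctions_op_iff] at hg
    obtain ⟨f, -, hf⟩ := hsurj (show (fun x => g x - g 0) ∈ rightInvV0 R from
      ⟨sub_self _, fun u x => by simp only [hg]⟩)
    have hg' : ∀ x, g x = ∑ r, w (r * x) * f r + g 0 := fun x => by
      have := congrFun hf x
      simp only [correlation] at this
      rw [this]; ring
    rw [sum_congr rfl fun i _ => hg' _, sum_congr rfl fun i _ => hg' ((c : Fin n → R) i),
      sum_add_distrib, sum_add_distrib]
    congr 1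
    rw [sum_comm, sum_comm (s := univ (α := Fin n))]
    refine sum_congr rfl fun r _ => ?_
    rw [← sum_mul, ← sum_mul]
    simpa using congrArg (· * f r) (hφ (r • c))
  obtain ⟨π, u, hu⟩ := exists_perm_smul_eq_of_sum_eq hFrob
    (fun i => LinearMap.proj i ∘ₗ C.subtype) (fun i => LinearMap.proj i ∘ₗ φ) hinv
  refine ⟨π, fun i => (Units.opEquiv (u i)).unop, fun i x => (hbi _ x).2, fun c i => ?_⟩
  simpa [Units.smul_def] using LinearMap.congr_fun (hu i) c

end Extension

/-- a bi-invariant weight `w` with `w 0 = 0` on a finite Frobenius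
ring satisfies the Extension Property if and only if the correlation map
`f ↦ wf` is a bijection from the left-invariant functions vanishing at `0`
onto the right-invariant functions vanishing at `0`. -/
theorem stmt5 (R : Type) [Ring R] [Fintype R] (hFrob : IsFrobenius R)
    (w : R → ℚ)
    (hbi : ∀ (u : Rˣ) (x : R), w ((u : R) * x) = w x ∧ w (x * (u : R)) = w x)
    (h0 : w 0 = 0) :
    ExtensionProperty R w ↔
      Set.BijOn (correlation R w) (leftInvV0 R) (rightInvV0 R) :=
  ⟨fun hE => hE.bijOn_correlation hFrob hbi h0,
    fun h => extensionProperty_of_surjOn hFrob hbi h.surjOn⟩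
end

section
/- Let R be a finite principal ideal ring, let w : R → ℚ be a bi-invariant weight, and let a ∈ R. For each right ideal J of R choose a generator g(J) ∈ R with g(J)R = J (the values below are independent of these choices, by the invariance of w). Then ∑_{J} w(a·g(J)) · μ((Ra)^⊥, J), the sum over all right ideals J of R, equals ∑_{J ≤ aR} w(g(J)) · μ(0, J), the sum over all right ideals J contained in aR. Here (Ra)^⊥ = {y ∈ R : ay = 0} and μ is the Möbius function of the lattice of right ideals of R. -/
open scoped Classical

/-- The right annihilator of a left ideal `L`, as a right ideal. -/
def rAnn (R : Type) [Ring R] (L : Submodule R R) : Submodule Rᵐᵒᵖ R where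
  carrier := {y : R | ∀ a ∈ L, a * y = 0}
  zero_mem' := fun a _ => mul_zero a
  add_mem' := by
    intro y z hy hz a ha
    rw [mul_add, hy a ha, hz a ha, add_zero]
  smul_mem' := by
    intro c y hy a ha
    rw [MulOpposite.smul_eq_mul_unop, ← mul_assoc, hy a ha, zero_mul]

noncomputable instance (R : Type) [Ring R] [Fintype R] :
    Fintype (Submodule Rᵐᵒᵖ R) := Fintype.ofFinite _

/-- Every element of a semisimple ring is von Neumann regular. -/
theorem IsSemisimpleRing.exists_mul_mul_self {S : Type*} [Ring S] [IsSemisimpleRing S] (b : S) :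
    ∃ x, b * x * b = b := by
  obtain ⟨e, he, hspan⟩ := IsSemisimpleRing.ideal_eq_span_idempotent (Ideal.span {b})
  obtain ⟨x, hx⟩ := Ideal.mem_span_singleton'.1 (hspan ▸ Ideal.mem_span_singleton_self e)
  obtain ⟨z, hz⟩ := Ideal.mem_span_singleton'.1 (hspan ▸ Ideal.mem_span_singleton_self b)
  refine ⟨x, ?_⟩
  rw [mul_assoc, hx, ← hz, mul_assoc, he.eq]

/-- In a finite ring, if `b` is not invertible but `b * x * b = b`, then the idempotents
`1 - b * x` and `1 - x * b` are linked by a nonzero element. -/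
theorem exists_one_sub_mul_mul_one_sub_ne_zero {S : Type*} [Ring S] [Finite S] {b x : S}
    (hx : b * x * b = b) (hb : ¬ IsUnit b) : ∃ r, (1 - b * x) * r * (1 - x * b) ≠ 0 := by
  by_contra! h
  let I : Set S := {y | ∀ r, (1 - b * x) * r * y = 0}
  have hsurj : Set.SurjOn (b * ·) I I := by
    intro y hy
    refine ⟨x * y, fun r => ?_, ?_⟩
    · simpa only [mul_assoc] using hy (r * x)
    · have := hy 1
      rw [mul_one, sub_mul, one_mul, sub_eq_zero] at this
      simpa only [mul_assoc] using this.symm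
  have hmaps : Set.MapsTo (b * ·) I I := by
    intro y hy r
    simpa only [mul_assoc] using hy (r * b)
  have hinj : Set.InjOn (b * ·) I :=
    ((Set.toFinite I).surjOn_iff_bijOn_of_mapsTo hmaps).1 hsurj |>.injOn
  have he : 1 - x * b = 0 := hinj (h ·) (fun r => mul_zero _) <| by
    simp [mul_sub, ← mul_assoc, hx]
  exact hb (IsUnit.of_mul_eq_one_right x (sub_eq_zero.1 he).symm)

/-- Finite semisimple rings have stable range one. -/
theorem IsSemisimpleRing.exists_isUnit_add_mul {S : Type*} [Ring S] [Finite S]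
    [IsSemisimpleRing S] {b c d : S} (h : b * c + d = 1) : ∃ t, IsUnit (b + d * t) := by
  obtain ⟨t, ht⟩ := Finite.exists_max fun t => (Set.range fun y => (b + d * t) * y).ncard
  refine ⟨t, by_contra fun hu => ?_⟩
  obtain ⟨x, hx⟩ := IsSemisimpleRing.exists_mul_mul_self (b + d * t)
  obtain ⟨r, hr⟩ := exists_one_sub_mul_mul_one_sub_ne_zero hx hu
  set b' := b + d * t with hb'
  set e := 1 - x * b' with he
  have hbe : b' * e = 0 := by simp [he, mul_sub, ← mul_assoc, hx]
  have hee : e * e = e := by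
    nth_rw 1 [he]
    rw [sub_mul, mul_assoc, hbe]
    simp
  have hfb : (1 - b' * x) * b' = 0 := by rw [sub_mul, hx, one_mul, sub_self]
  have hsum : b' * c + d * (1 - t * c) = 1 := by
    refine Eq.trans ?_ h
    rw [hb']
    noncomm_ring
  let s := (1 - t * c) * r * e
  have hse : s * e = s := by simp only [s, mul_assoc, hee]
  have hds : (1 - b' * x) * (d * s) ≠ 0 := by
    convert hr using 1
    have : (1 - b' * x) * (d * (1 - t * c)) = 1 - b' * x := by
      rw [eq_sub_of_add_eq' hsum, mul_sub, ← mul_assoc, hfb, mul_one, zero_mul, sub_zero]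
    conv_rhs => rw [← this]
    simp only [s, mul_assoc]
  have hb'e : (b + d * (t + s)) * e = d * s := by
    rw [mul_add, ← add_assoc, ← hb', add_mul, hbe, zero_add, mul_assoc, hse]
  have hb'1e : (b + d * (t + s)) * (1 - e) = b' := by
    rw [mul_sub, hb'e, mul_one, hb']; noncomm_ring
  refine (ht (t + s)).not_gt (Set.ncard_lt_ncard ⟨?_, fun hle => ?_⟩ (Set.toFinite _))
  · rintro _ ⟨y, rfl⟩
    exact ⟨(1 - e) * y, by simp only [← mul_assoc, hb'1e]⟩
  · obtain ⟨y, hy⟩ := hle ⟨e, hb'e⟩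
    apply hds
    rw [← hy]
    simp only [← mul_assoc, hfb, zero_mul]

/-- Units lift along the quotient of a finite ring by its Jacobson radical. -/
theorem isUnit_of_isUnit_mk_jacobson {R : Type*} [Ring R] [Finite R] {b : R}
    (hb : IsUnit (Ideal.Quotient.mk (Ring.jacobson R) b)) : IsUnit b := by
  obtain ⟨v, hv⟩ := hb.exists_left_inv
  obtain ⟨v, rfl⟩ := Ideal.Quotient.mk_surjective v
  rw [← map_mul, ← map_one (Ideal.Quotient.mk _), Ideal.Quotient.eq, ← Ideal.jacobson_bot] at hv
  obtain ⟨s, hs⟩ := Ideal.exists_mul_sub_mem_of_sub_one_mem_jacobson _ hv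
  rw [Ideal.mem_bot, sub_eq_zero, ← mul_assoc] at hs
  exact IsUnit.of_mul_eq_one_right _ hs

/-- Finite rings have stable range one. -/
theorem Finite.exists_isUnit_add_mul {R : Type*} [Ring R] [Finite R] {b c d : R}
    (h : b * c + d = 1) : ∃ t, IsUnit (b + d * t) := by
  have : Finite (R ⧸ Ring.jacobson R) :=
    Finite.of_surjective _ (Ideal.Quotient.mk_surjective (I := Ring.jacobson R))
  obtain ⟨t, ht⟩ := IsSemisimpleRing.exists_isUnit_add_mul
    (b := Ideal.Quotient.mk (Ring.jacobson R) b) (c := Ideal.Quotient.mk _ c)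
    (d := Ideal.Quotient.mk _ d) (by rw [← map_mul, ← map_add, h, map_one])
  obtain ⟨t, rfl⟩ := Ideal.Quotient.mk_surjective t
  exact ⟨t, isUnit_of_isUnit_mk_jacobson (by simpa using ht)⟩

/-- Two generators of the same right ideal of a finite ring differ by a unit. -/
theorem exists_units_mul_eq_of_span_eq {R : Type*} [Ring R] [Finite R] {x y : R}
    (h : Submodule.span Rᵐᵒᵖ {x} = Submodule.span Rᵐᵒᵖ {y}) : ∃ u : Rˣ, y * u = x := by
  obtain ⟨b, hb⟩ := Submodule.mem_span_singleton.1 (h ▸ Submodule.mem_span_singleton_self x)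
  obtain ⟨c, hc⟩ := Submodule.mem_span_singleton.1 (h ▸ Submodule.mem_span_singleton_self y)
  rw [MulOpposite.smul_eq_mul_unop] at hb hc
  obtain ⟨t, u, hu⟩ := Finite.exists_isUnit_add_mul (add_sub_cancel (b.unop * c.unop) 1)
  refine ⟨u, ?_⟩
  rw [hu, mul_add, hb, ← mul_assoc, mul_sub, ← mul_assoc, hb, hc, mul_one, sub_self, zero_mul,
    add_zero]

section Submodule

variable {A M N Q : Type*} [Ring A] [AddCommGroup M] [AddCommGroup N] [Module A M] [Module A N]
  [Fintype (Submodule A M)] [Fintype (Submodule A N)]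

/-- The correspondence theorem as a change of variables: submodules of `J.map f` are the images
of the submodules between `ker f` and `J`. -/
theorem Submodule.sum_map_eq_sum_le_map [AddCommMonoid Q] (f : M →ₗ[A] N) {J : Submodule A M}
    (hJ : LinearMap.ker f ≤ J) (φ : Submodule A N → Q) :
    ∑ I ∈ Finset.univ.filter (fun I => LinearMap.ker f ≤ I ∧ I ≤ J), φ (I.map f) =
      ∑ L ∈ Finset.univ.filter (fun L => L ≤ J.map f), φ L := by
  have hcomap : ∀ I : Submodule A M, LinearMap.ker f ≤ I → (I.map f).comap f = I := fun I hI => by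
    rw [Submodule.comap_map_eq, sup_eq_left.2 hI]
  refine Finset.sum_bij' (fun I _ => I.map f) (fun L _ => L.comap f) ?_ ?_ ?_ ?_ ?_
  · intro I hI
    simp only [Finset.mem_filter, Finset.mem_univ, true_and] at hI ⊢
    exact Submodule.map_mono hI.2
  · intro L hL
    simp only [Finset.mem_filter, Finset.mem_univ, true_and] at hL ⊢
    exact ⟨LinearMap.ker_le_comap f, (Submodule.comap_mono hL).trans (hcomap J hJ).le⟩
  · intro I hI
    exact hcomap I (Finset.mem_filter.1 hI).2.1
  · intro L hL
    exact Submodule.map_comap_eq_self ((Finset.mem_filter.1 hL).2.trans LinearMap.map_le_range)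
  · intro I _
    rfl

/-- Möbius functions of submodule lattices agree along the correspondence theorem. -/
theorem Submodule.moebius_ker_eq_moebius_bot_map [AddCommGroup Q] (f : M →ₗ[A] N) (q : Q)
    {μ : Submodule A M → Q} {ν : Submodule A N → Q}
    (hμ₁ : μ (LinearMap.ker f) = q)
    (hμ₂ : ∀ J, LinearMap.ker f < J →
      ∑ I ∈ Finset.univ.filter (fun I => LinearMap.ker f ≤ I ∧ I ≤ J), μ I = 0)
    (hν₁ : ν ⊥ = q)
    (hν₂ : ∀ J, ⊥ < J → ∑ I ∈ Finset.univ.filter (fun I => ⊥ ≤ I ∧ I ≤ J), ν I = 0)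
    (J : Submodule A M) (hJ : LinearMap.ker f ≤ J) : μ J = ν (J.map f) := by
  induction J using WellFoundedLT.induction with
  | ind J ih =>
    obtain rfl | hlt := hJ.eq_or_lt
    · have : (LinearMap.ker f).map f = ⊥ := (LinearMap.le_ker_iff_map).1 le_rfl
      rw [hμ₁, this, hν₁]
    · have hbot : ⊥ < J.map f :=
        bot_lt_iff_ne_bot.2 fun h => hlt.not_ge (LinearMap.le_ker_iff_map.2 h)
      have hν := hν₂ _ hbot
      simp only [bot_le, true_and] at hν
      rw [← Submodule.sum_map_eq_sum_le_map f hJ] at hν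
      have hsub := (Finset.sum_sub_distrib μ (fun I => ν (I.map f))).trans
        (sub_eq_zero.2 ((hμ₂ J hlt).trans hν.symm))
      rw [Finset.sum_eq_single_of_mem J (by simp [hJ])] at hsub
      · exact sub_eq_zero.1 hsub
      · intro I hI hne
        obtain ⟨hKI, hIJ⟩ := (Finset.mem_filter.1 hI).2
        exact sub_eq_zero.2 (ih I (lt_of_le_of_ne hIJ hne) hKI)

end Submodule

theorem rAnn_span_singleton (R : Type) [Ring R] (a : R) :
    rAnn R (Submodule.span R {a}) = LinearMap.ker (LinearMap.mulLeft Rᵐᵒᵖ a) := by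
  ext y
  change (∀ z ∈ Submodule.span R {a}, z * y = 0) ↔ a * y = 0
  refine ⟨fun h => h a (Submodule.mem_span_singleton_self a), fun h z hz => ?_⟩
  obtain ⟨r, rfl⟩ := Submodule.mem_span_singleton.1 hz
  rw [smul_eq_mul, mul_assoc, h, mul_zero]

/-- over a finite principal ideal ring, for a bi-invariant weight
`w` and `a ∈ R`, with `g J` a chosen generator of each right ideal `J`,
`∑_J w(a·g(J))·μ((Ra)^⊥, J) = ∑_{J ≤ aR} w(g(J))·μ(0, J)` (diagonal entries
of `WQ`). -/
theorem stmt9 (R : Type) [Ring R] [Fintype R]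
    (hlp : ∀ L : Submodule R R, ∃ a : R, L = Submodule.span R {a})
    (hrp : ∀ J : Submodule Rᵐᵒᵖ R, ∃ a : R, J = Submodule.span Rᵐᵒᵖ {a})
    (w : R → ℚ)
    (hbi : ∀ (u : Rˣ) (x : R), w ((u : R) * x) = w x ∧ w (x * (u : R)) = w x)
    (a : R)
    (μ : Submodule Rᵐᵒᵖ R → Submodule Rᵐᵒᵖ R → ℚ)
    (hμ₁ : ∀ I, μ I I = 1)
    (hμ₂ : ∀ I J, I < J →
      ∑ K ∈ Finset.univ.filter (fun K => I ≤ K ∧ K ≤ J), μ I K = 0)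
    (hμ₃ : ∀ I J, ¬ I ≤ J → μ I J = 0)
    (g : Submodule Rᵐᵒᵖ R → R)
    (hg : ∀ J, Submodule.span Rᵐᵒᵖ {g J} = J) :
    ∑ J : Submodule Rᵐᵒᵖ R, w (a * g J) * μ (rAnn R (Submodule.span R {a})) J
      = ∑ J ∈ Finset.univ.filter
          (fun J : Submodule Rᵐᵒᵖ R => J ≤ Submodule.span Rᵐᵒᵖ {a}),
          w (g J) * μ ⊥ J := by
  have hspan : ∀ J : Submodule Rᵐᵒᵖ R, J.map (LinearMap.mulLeft Rᵐᵒᵖ a) =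
      Submodule.span Rᵐᵒᵖ {a * g J} := fun J => by
    conv_lhs => rw [← hg J]
    rw [Submodule.map_span, Set.image_singleton, LinearMap.mulLeft_apply]
  have hw : ∀ J : Submodule Rᵐᵒᵖ R,
      w (a * g J) = w (g (J.map (LinearMap.mulLeft Rᵐᵒᵖ a))) := fun J => by
    obtain ⟨u, hu⟩ := exists_units_mul_eq_of_span_eq ((hspan J).symm.trans (hg _).symm)
    rw [← hu, (hbi u _).2]
  have htop : (⊤ : Submodule Rᵐᵒᵖ R).map (LinearMap.mulLeft Rᵐᵒᵖ a) =
      Submodule.span Rᵐᵒᵖ {a} := by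
    have : (⊤ : Submodule Rᵐᵒᵖ R) = Submodule.span Rᵐᵒᵖ {1} :=
      (Submodule.eq_top_iff'.2 fun x =>
        Submodule.mem_span_singleton.2 ⟨MulOpposite.op x, by simp⟩).symm
    rw [this, Submodule.map_span, Set.image_singleton, LinearMap.mulLeft_apply, mul_one]
  rw [rAnn_span_singleton, ← htop, ← Submodule.sum_map_eq_sum_le_map _ le_top]
  simp only [le_top, and_true]
  rw [Finset.sum_filter]
  refine Finset.sum_congr rfl fun J _ => ?_
  split_ifs with hJ
  · rw [hw, Submodule.moebius_ker_eq_moebius_bot_map (LinearMap.mulLeft Rᵐᵒᵖ a) 1 (hμ₁ _)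
      (hμ₂ _) (hμ₁ _) (hμ₂ _) J hJ]
  · rw [hμ₃ _ _ hJ, mul_zero]
end

section
/- Let R be a finite principal ideal ring, let w : R → ℚ be a bi-invariant weight, and let a, b ∈ R with Rb ≰ Ra. For each right ideal J of R choose a generator g(J) ∈ R with g(J)R = J (the values below are independent of these choices). Then ∑_{J} w(a·g(J)) · μ((Rb)^⊥, J) = 0, where the sum is over all right ideals J of R, (Rb)^⊥ = {y ∈ R : by = 0}, and μ is the Möbius function of the lattice of right ideals of R. (This is the lower triangularity of the matrix WQ.) -/
open scoped Classical

/-- A function on a finite poset is determined by its sums over the principal lower sets. -/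
theorem eq_of_sum_le_eq {P A : Type*} [PartialOrder P] [Fintype P] [AddCommGroup A]
    {f g : P → A} (h : ∀ k, ∑ j with j ≤ k, f j = ∑ j with j ≤ k, g j) : f = g := by
  funext k
  induction k using WellFoundedLT.induction with
  | ind k ih =>
    have hk := h k
    have hmem : k ∈ Finset.univ.filter (fun j => j ≤ k) := by simp
    rw [← Finset.add_sum_erase _ f hmem, ← Finset.add_sum_erase _ g hmem] at hk
    have hrest : ∑ j ∈ (Finset.univ.filter (fun j => j ≤ k)).erase k, f j
        = ∑ j ∈ (Finset.univ.filter (fun j => j ≤ k)).erase k, g j := by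
      refine Finset.sum_congr rfl fun j hj => ih j ?_
      simp only [Finset.mem_erase, Finset.mem_filter, Finset.mem_univ, true_and] at hj
      exact lt_of_le_of_ne hj.2 hj.1
    rw [hrest] at hk
    exact add_right_cancel hk

/-- Weisner's theorem: for `¬ k ≤ i`, the Möbius function `μ i` is orthogonal to every function
that depends only on `j ⊔ k`. -/
theorem sum_sup_mul_moebius_eq_zero {P : Type*} [Lattice P] [Fintype P] (m : P → ℚ) {i k : P}
    (hm : ∀ j, i < j → ∑ l with i ≤ l ∧ l ≤ j, m l = 0) (hm' : ∀ j, ¬ i ≤ j → m j = 0)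
    (hki : ¬ k ≤ i) (F : P → ℚ) : ∑ j, F (j ⊔ k) * m j = 0 := by
  have hfib : (fun n => ∑ j with j ⊔ k = n, m j) = fun _ => 0 := by
    refine eq_of_sum_le_eq fun n => ?_
    have hsum : ∑ n' with n' ≤ n, ∑ j with j ⊔ k = n', m j = ∑ j with j ⊔ k ≤ n, m j := by
      rw [← Finset.sum_fiberwise_of_maps_to (s := Finset.univ.filter (fun j => j ⊔ k ≤ n))
        (t := Finset.univ.filter (fun n' => n' ≤ n)) (g := fun j => j ⊔ k) (by simp)]
      refine Finset.sum_congr rfl fun n' hn' => Finset.sum_congr ?_ fun _ _ => rfl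
      ext j
      simp only [Finset.mem_filter, Finset.mem_univ, true_and] at hn' ⊢
      exact ⟨fun h => ⟨h ▸ hn', h⟩, fun h => h.2⟩
    rw [hsum, Finset.sum_const_zero]
    by_cases hkn : k ≤ n
    · by_cases hin : i ≤ n
      · rw [← hm n (lt_of_le_of_ne hin fun h => hki (h ▸ hkn)), Finset.sum_filter,
          Finset.sum_filter]
        refine Finset.sum_congr rfl fun j _ => ?_
        by_cases hij : i ≤ j <;> simp [hij, hkn, hm']
      · refine Finset.sum_eq_zero fun j hj => hm' j fun hij => hin ?_
        simp only [Finset.mem_filter, Finset.mem_univ, true_and] at hj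
        exact hij.trans (le_sup_left.trans hj)
    · refine Finset.sum_eq_zero fun j hj => absurd ?_ hkn
      simp only [Finset.mem_filter, Finset.mem_univ, true_and] at hj
      exact le_sup_right.trans hj
  rw [← Finset.sum_fiberwise Finset.univ (fun j => j ⊔ k)]
  refine Finset.sum_eq_zero fun n _ => ?_
  have hn : ∑ j with j ⊔ k = n, m j = 0 := congrFun hfib n
  rw [← mul_zero (F n), ← hn, Finset.mul_sum]
  refine Finset.sum_congr rfl fun j hj => ?_
  rw [(Finset.mem_filter.1 hj).2]

theorem mem_span_op_singleton {R : Type*} [Ring R] {x y : R} :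
    y ∈ Submodule.span Rᵐᵒᵖ {x} ↔ ∃ r, x * r = y := by
  rw [Submodule.mem_span_singleton]
  exact ⟨fun ⟨c, hc⟩ => ⟨c.unop, hc⟩, fun ⟨r, hr⟩ => ⟨MulOpposite.op r, hr⟩⟩

/-- In a finite ring, generators of the same principal right ideal differ by a unit. -/
theorem exists_unit_mul_eq {R : Type*} [Ring R] [Fintype R] {x y s t : R}
    (hs : x * s = y) (ht : y * t = x) : ∃ u : Rˣ, x * u = y := by
  have : Fintype (Submodule Rᵐᵒᵖ R) := Fintype.ofFinite _
  let n : R → Submodule Rᵐᵒᵖ R → ℤ := fun z K =>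
    ((Finset.univ.filter fun r : R => x * r = z ∧ Submodule.span Rᵐᵒᵖ {r} = K).card : ℤ)
  have hsum : ∀ z K, ∑ K' with K' ≤ K, n z K' =
      ((Finset.univ.filter fun r : R => x * r = z ∧ r ∈ K).card : ℤ) := by
    intro z K
    rw [Finset.card_eq_sum_card_fiberwise (f := fun r : R => Submodule.span Rᵐᵒᵖ {r})
      (t := Finset.univ.filter (fun K' => K' ≤ K)), Nat.cast_sum]
    · refine Finset.sum_congr rfl fun K' hK' => ?_
      simp only [n, Finset.filter_filter]
      congr 2
      ext r
      simp only [Finset.mem_filter, Finset.mem_univ, true_and] at hK' ⊢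
      constructor
      · rintro ⟨h, rfl⟩
        exact ⟨⟨h, hK' (Submodule.mem_span_singleton_self r)⟩, rfl⟩
      · rintro ⟨⟨h, -⟩, h'⟩
        exact ⟨h, h'⟩
    · intro r hr
      simp only [Finset.coe_filter, Finset.mem_univ, true_and, Set.mem_ofPred_eq] at hr ⊢
      simpa using hr.2
  have hmul : ∀ (K : Submodule Rᵐᵒᵖ R) (r c : R), r ∈ K → r * c ∈ K := fun K r c hr =>
    K.smul_mem (MulOpposite.op c) hr
  have hn : n y = n x := by
    refine eq_of_sum_le_eq fun K => ?_
    rw [hsum, hsum]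
    norm_cast
    by_cases hK : ∃ r ∈ K, x * r = y
    · obtain ⟨r, hr, hxr⟩ := hK
      have hd : r * t - r ∈ K := K.sub_mem (hmul K r t hr) hr
      have hxd : x * (r * t - r) = x - y := by rw [mul_sub, ← mul_assoc, hxr, ht]
      refine Finset.card_bij (fun q _ => q + (r * t - r)) ?_ (fun _ _ _ _ h => add_right_cancel h) ?_
      · intro q hq
        simp only [Finset.mem_filter, Finset.mem_univ, true_and] at hq ⊢
        exact ⟨by rw [mul_add, hxd, hq.1, add_sub_cancel], K.add_mem hq.2 hd⟩
      · intro q hq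
        simp only [Finset.mem_filter, Finset.mem_univ, true_and] at hq ⊢
        exact ⟨q - (r * t - r), ⟨by rw [mul_sub, hxd, hq.1, sub_sub_cancel], K.sub_mem hq.2 hd⟩,
          sub_add_cancel _ _⟩
    · rw [Finset.filter_false_of_mem, Finset.filter_false_of_mem]
      · exact fun r _ h => hK ⟨r * s, hmul K r s h.2, by rw [← mul_assoc, h.1, hs]⟩
      · exact fun r _ h => hK ⟨r, h.2, h.1⟩
  have hpos : 0 < n y ⊤ := by
    rw [hn]
    simp only [n, Nat.cast_pos, Finset.card_pos]
    refine ⟨1, ?_⟩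
    simp only [Finset.mem_filter, Finset.mem_univ, mul_one, true_and, eq_top_iff]
    exact fun z _ => mem_span_op_singleton.2 ⟨z, one_mul z⟩
  simp only [n, Nat.cast_pos, Finset.card_pos] at hpos
  obtain ⟨r, hr⟩ := hpos
  simp only [Finset.mem_filter, Finset.mem_univ, true_and] at hr
  obtain ⟨v, hv⟩ := mem_span_op_singleton.1 (hr.2 ▸ Submodule.mem_top : (1 : R) ∈ _)
  exact ⟨⟨r, v, hv, mul_eq_one_symm hv⟩, hr.1⟩

/-- The total size of the two one-sided ideals generated by `a`. -/
noncomputable def sideCard {R : Type*} [Ring R] (a : R) : ℕ :=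
  (Set.range fun r => r * a).ncard + (Set.range fun r => a * r).ncard

theorem sideCard_op {R : Type*} [Ring R] (a : R) :
    sideCard (MulOpposite.op a) = sideCard a := by
  have hl : (Set.range fun r => r * MulOpposite.op a)
      = MulOpposite.op '' Set.range fun r => a * r := by
    rw [← Set.range_comp, ← MulOpposite.op_surjective.range_comp]
    rfl
  have hr : (Set.range fun r => MulOpposite.op a * r)
      = MulOpposite.op '' Set.range fun r => r * a := by
    rw [← Set.range_comp, ← MulOpposite.op_surjective.range_comp]
    rfl
  rw [sideCard, sideCard, hl, hr, Set.ncard_image_of_injective _ MulOpposite.op_injective,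
    Set.ncard_image_of_injective _ MulOpposite.op_injective, add_comm]

/-- If left ideals are principal and the double annihilator property `r(l(z)) = zR` holds for
all `z` generating larger ideals than `a`, then `l(r(a)) = Ra`. -/
theorem exists_eq_mul_of_rightAnn_le {R : Type*} [Ring R] [Finite R]
    (hlp : ∀ L : Submodule R R, ∃ a : R, L = Submodule.span R {a}) (a : R)
    (hz : ∀ z : R, sideCard a < sideCard z →
      ∀ y, (∀ q, q * z = 0 → q * y = 0) → ∃ c, z * c = y)
    {b : R} (hb : ∀ y, a * y = 0 → b * y = 0) : ∃ c, c * a = b := by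
  let L : Submodule R R :=
    { carrier := {x | ∀ y, a * y = 0 → x * y = 0}
      zero_mem' := fun y _ => zero_mul y
      add_mem' := fun {p q} hp hq y hy => by rw [add_mul, hp y hy, hq y hy, add_zero]
      smul_mem' := fun c x hx y hy => by rw [smul_eq_mul, mul_assoc, hx y hy, mul_zero] }
  obtain ⟨z, hLz⟩ := hlp L
  have hzL : ∀ x, (∀ y, a * y = 0 → x * y = 0) ↔ ∃ c, c * z = x := fun x => by
    change x ∈ L ↔ _
    rw [hLz, Submodule.mem_span_singleton]
    rfl
  obtain ⟨t, rfl⟩ := (hzL a).1 fun _ h => h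
  have hann : ∀ y, t * z * y = 0 → z * y = 0 := (hzL z).2 ⟨1, one_mul z⟩
  obtain ⟨d, rfl⟩ := (hzL b).1 hb
  suffices h : ∃ c, c * (t * z) = z by
    obtain ⟨c, hc⟩ := h
    exact ⟨d * c, by rw [mul_assoc, hc]⟩
  by_contra hne
  have hleft : (Set.range fun r => r * (t * z)).ncard < (Set.range fun r => r * z).ncard := by
    refine Set.ncard_lt_ncard ⟨?_, fun h => ?_⟩ (Set.toFinite _)
    · rintro _ ⟨r, rfl⟩
      exact ⟨r * t, mul_assoc r t z⟩
    · exact hne (h ⟨1, one_mul z⟩)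
  have hright : (Set.range fun r => t * z * r).ncard = (Set.range fun r => z * r).ncard := by
    have himage : (Set.range fun r => t * z * r) = (fun x => t * x) '' Set.range fun r => z * r := by
      rw [← Set.range_comp]
      exact congrArg Set.range (funext fun r => mul_assoc t z r)
    rw [himage, Set.InjOn.ncard_image]
    rintro _ ⟨p, rfl⟩ _ ⟨q, rfl⟩ h
    have h0 := hann (p - q) (by rw [mul_sub, sub_eq_zero]; simpa only [mul_assoc] using h)
    rwa [mul_sub, sub_eq_zero] at h0
  have hclosed := hz z (by rw [sideCard, sideCard]; omega)
  obtain ⟨f, hf⟩ := hlp (Submodule.span R {t} ⊔ LinearMap.ker (LinearMap.toSpanSingleton R R z))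
  have hfin : ∀ x ∈ Submodule.span R {t} ⊔ LinearMap.ker (LinearMap.toSpanSingleton R R z),
      ∃ c, c * f = x := fun x hx => by
    rw [hf, Submodule.mem_span_singleton] at hx
    exact hx
  have hinj : Function.Injective fun y => f * y := by
    intro p q hpq
    have hf0 : f * (p - q) = 0 := by rw [mul_sub, sub_eq_zero]; exact hpq
    have hx0 : ∀ x ∈ Submodule.span R {t} ⊔ LinearMap.ker (LinearMap.toSpanSingleton R R z),
        x * (p - q) = 0 := fun x hx => by
      obtain ⟨c, rfl⟩ := hfin x hx
      rw [mul_assoc, hf0, mul_zero]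
    obtain ⟨e, he⟩ := hclosed (p - q) fun r hr => hx0 r (Submodule.mem_sup_right (by simpa using hr))
    have ht0 := hx0 t (Submodule.mem_sup_left (Submodule.mem_span_singleton_self t))
    rw [← he, ← mul_assoc] at ht0
    rw [← sub_eq_zero, ← he, hann e ht0]
  obtain ⟨v, hv⟩ := (Finite.injective_iff_surjective.1 hinj) 1
  have hone : (1 : R) ∈ Submodule.span R {t} ⊔ LinearMap.ker (LinearMap.toSpanSingleton R R z) := by
    rw [hf, Submodule.mem_span_singleton]
    exact ⟨v, mul_eq_one_symm hv⟩
  obtain ⟨p, hp, q, hq, hpq⟩ := Submodule.mem_sup.1 hone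
  obtain ⟨c, rfl⟩ := Submodule.mem_span_singleton.1 hp
  refine hne ⟨c, ?_⟩
  have hq0 : q * z = 0 := by simpa using hq
  calc c * (t * z) = (c • t + q) * z := by rw [add_mul, hq0, add_zero, smul_eq_mul, mul_assoc]
    _ = z := by rw [hpq, one_mul]

theorem forall_exists_eq_span_op {R : Type*} [Ring R]
    (hrp : ∀ J : Submodule Rᵐᵒᵖ R, ∃ a : R, J = Submodule.span Rᵐᵒᵖ {a})
    (L : Submodule Rᵐᵒᵖ Rᵐᵒᵖ) : ∃ a : Rᵐᵒᵖ, L = Submodule.span Rᵐᵒᵖ {a} := by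
  let J : Submodule Rᵐᵒᵖ R :=
    { carrier := {x | MulOpposite.op x ∈ L}
      zero_mem' := L.zero_mem
      add_mem' := fun hp hq => L.add_mem hp hq
      smul_mem' := fun c _ hx => L.smul_mem c hx }
  obtain ⟨a, ha⟩ := hrp J
  refine ⟨MulOpposite.op a, ?_⟩
  ext x
  have hx : x ∈ L ↔ x.unop ∈ J := Iff.rfl
  rw [hx, ha, mem_span_op_singleton, Submodule.mem_span_singleton]
  constructor
  · rintro ⟨r, hr⟩
    exact ⟨MulOpposite.op r, MulOpposite.unop_injective hr⟩
  · rintro ⟨c, rfl⟩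
    exact ⟨c.unop, rfl⟩

/-- Both double annihilator properties hold in a finite principal ideal ring. -/
theorem doubleAnnihilator {R : Type*} [Ring R] [Finite R]
    (hlp : ∀ L : Submodule R R, ∃ a : R, L = Submodule.span R {a})
    (hrp : ∀ J : Submodule Rᵐᵒᵖ R, ∃ a : R, J = Submodule.span Rᵐᵒᵖ {a}) (a : R) :
    (∀ b, (∀ y, a * y = 0 → b * y = 0) → ∃ c, c * a = b) ∧
      ∀ b, (∀ y, y * a = 0 → y * b = 0) → ∃ c, a * c = b := by
  have hwf : WellFounded fun x y : R => sideCard y < sideCard x :=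
    have : IsTrans R fun x y : R => sideCard y < sideCard x := ⟨fun _ _ _ h h' => h'.trans h⟩
    have : Std.Irrefl fun x y : R => sideCard y < sideCard x := ⟨fun _ => lt_irrefl _⟩
    Finite.wellFounded_of_trans_of_irrefl _
  have : Finite Rᵐᵒᵖ := Finite.of_equiv R MulOpposite.opEquiv
  induction a using hwf.induction with
  | _ a ih =>
    refine ⟨fun b hb => exists_eq_mul_of_rightAnn_le hlp a (fun z hz => (ih z hz).2) hb,
      fun b hb => ?_⟩
    obtain ⟨c, hc⟩ := exists_eq_mul_of_rightAnn_le (forall_exists_eq_span_op hrp)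
      (MulOpposite.op a) (b := MulOpposite.op b)
      (fun z hz y hy => by
        obtain ⟨c, hc⟩ := (ih z.unop (by
          rwa [sideCard_op, ← MulOpposite.op_unop z, sideCard_op] at hz)).1 y.unop
            fun q hq => congrArg MulOpposite.unop
              (hy (MulOpposite.op q) (MulOpposite.unop_injective hq))
        exact ⟨MulOpposite.op c, MulOpposite.unop_injective hc⟩)
      (fun y hy => MulOpposite.unop_injective (hb y.unop (congrArg MulOpposite.unop hy)))
    exact ⟨c.unop, congrArg MulOpposite.unop hc⟩

/-- over a finite principal ideal ring, for a bi-invariant weight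
`w` and `a, b ∈ R` with `Rb ≰ Ra`, with `g J` a chosen generator of each right
ideal `J`, `∑_J w(a·g(J))·μ((Rb)^⊥, J) = 0` (lower triangularity of `WQ`). -/
theorem stmt10 (R : Type) [Ring R] [Fintype R]
    (hlp : ∀ L : Submodule R R, ∃ a : R, L = Submodule.span R {a})
    (hrp : ∀ J : Submodule Rᵐᵒᵖ R, ∃ a : R, J = Submodule.span Rᵐᵒᵖ {a})
    (w : R → ℚ)
    (hbi : ∀ (u : Rˣ) (x : R), w ((u : R) * x) = w x ∧ w (x * (u : R)) = w x)
    (a b : R)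
    (hba : ¬ Submodule.span R {b} ≤ Submodule.span R {a})
    (μ : Submodule Rᵐᵒᵖ R → Submodule Rᵐᵒᵖ R → ℚ)
    (hμ₁ : ∀ I, μ I I = 1)
    (hμ₂ : ∀ I J, I < J →
      ∑ K ∈ Finset.univ.filter (fun K => I ≤ K ∧ K ≤ J), μ I K = 0)
    (hμ₃ : ∀ I J, ¬ I ≤ J → μ I J = 0)
    (g : Submodule Rᵐᵒᵖ R → R)
    (hg : ∀ J, Submodule.span Rᵐᵒᵖ {g J} = J) :
    ∑ J : Submodule Rᵐᵒᵖ R, w (a * g J) * μ (rAnn R (Submodule.span R {b})) J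
      = 0 := by
  have hmem : ∀ c y : R, y ∈ rAnn R (Submodule.span R {c}) ↔ c * y = 0 := fun c y => by
    refine ⟨fun h => h c (Submodule.mem_span_singleton_self c), fun h x hx => ?_⟩
    obtain ⟨r, rfl⟩ := Submodule.mem_span_singleton.1 hx
    rw [smul_eq_mul, mul_assoc, h, mul_zero]
  have hki : ¬ rAnn R (Submodule.span R {a}) ≤ rAnn R (Submodule.span R {b}) := fun hle => by
    obtain ⟨c, hc⟩ := (doubleAnnihilator hlp hrp a).1 b fun y hy =>
      (hmem b y).1 (hle ((hmem a y).2 hy))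
    refine hba ((Submodule.span_singleton_le_iff_mem _ _).2 ?_)
    exact Submodule.mem_span_singleton.2 ⟨c, hc⟩
  have hgen : ∀ J x, x ∈ J → ∃ r, g J * r = x := fun J x hx =>
    mem_span_op_singleton.1 ((hg J).symm ▸ hx)
  have hgmem : ∀ J, g J ∈ J := fun J => by
    have h : g J ∈ Submodule.span Rᵐᵒᵖ {g J} := Submodule.mem_span_singleton_self _
    rwa [hg J] at h
  have hfac : ∀ J, w (a * g J) = w (a * g (J ⊔ rAnn R (Submodule.span R {a}))) := fun J => by
    obtain ⟨s, hs⟩ := hgen _ _ (Submodule.mem_sup_left (hgmem J) :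
      g J ∈ J ⊔ rAnn R (Submodule.span R {a}))
    obtain ⟨p, hp, q, hq, hpq⟩ := Submodule.mem_sup.1 (hgmem (J ⊔ rAnn R (Submodule.span R {a})))
    obtain ⟨t, rfl⟩ := hgen J p hp
    obtain ⟨u, hu⟩ := exists_unit_mul_eq (x := a * g (J ⊔ rAnn R (Submodule.span R {a})))
      (y := a * g J) (s := s) (t := t) (by rw [mul_assoc, hs])
      (by rw [← hpq, mul_add, (hmem a q).1 hq, add_zero, mul_assoc])
    rw [← hu, (hbi u _).2]
  rw [Finset.sum_congr rfl fun J _ => by rw [hfac J]]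
  exact sum_sup_mul_moebius_eq_zero (μ (rAnn R (Submodule.span R {b}))) (hμ₂ _) (hμ₃ _) hki
    fun K => w (a * g K)
end

section
/- Let m ≥ 2 and let w : ℤ/mℤ → ℚ be an invariant weight, i.e., w(ux) = w(x) for all x ∈ ℤ/mℤ and all units u. Then (ℤ/mℤ, w) satisfies the Extension Property if and only if for every positive divisor a of m such that m/a > 1 and m/a is squarefree: ∑_{s ∣ m/a} w(s·a) · μ(s) ≠ 0, where the sum is over positive divisors s of m/a, s·a is taken modulo m, and μ is the number-theoretic Möbius function. -/
open ArithmeticFunction (moebius)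
open Finset

namespace ZModWeight

variable {m : ℕ}

theorem addOrderOf_mul_unit (x : ZMod m) (u : (ZMod m)ˣ) :
    addOrderOf (x * u) = addOrderOf x :=
  addOrderOf_injective (AddMonoidHom.mulRight (u : ZMod m))
    (fun _ _ h => u.mul_left_inj.mp h) x

theorem exists_generator_of_range {M : Type*} [AddCommGroup M] [Module (ZMod m) M]
    (f : M →ₗ[ZMod m] ZMod m) :
    ∃ c₀, ∀ c, ∃ k, f c = k * f c₀ := by
  have : IsPrincipalIdealRing (ZMod m) :=
    IsPrincipalIdealRing.of_surjective (Int.castRingHom (ZMod m)) ZMod.intCast_surjective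
  obtain ⟨y, hy⟩ := (IsPrincipalIdealRing.principal (LinearMap.range f)).principal
  obtain ⟨c₀, hc₀⟩ : y ∈ LinearMap.range f := hy ▸ Submodule.mem_span_singleton_self y
  refine ⟨c₀, fun c => ?_⟩
  have hc : f c ∈ Submodule.span (ZMod m) {y} := hy ▸ LinearMap.mem_range_self f c
  obtain ⟨k, hk⟩ := Submodule.mem_span_singleton.mp hc
  exact ⟨k, by rw [hc₀, ← hk, smul_eq_mul]⟩

/-- The Extension Property applied to cyclic codes with generators `y` and `z`. -/
theorem exists_perm_of_generators {w : ZMod m → ℚ}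
    (hE : ExtensionProperty (ZMod m) w) {ι : Type*} [Fintype ι] (y z : ι → ZMod m) (i₀ : ι)
    (hy : y i₀ = 1) (hz : z i₀ = 1) (hyz : ∀ c, ∑ i, w (c * z i) = ∑ i, w (c * y i)) :
    ∃ (π : Equiv.Perm ι) (u : ι → (ZMod m)ˣ), ∀ i, z i = y (π i) * u i := by
  let e := Fintype.equivFin ι
  let Y : ZMod m →ₗ[ZMod m] (Fin (Fintype.card ι) → ZMod m) :=
    LinearMap.toSpanSingleton (ZMod m) _ (y ∘ e.symm)
  let Z : ZMod m →ₗ[ZMod m] (Fin (Fintype.card ι) → ZMod m) :=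
    LinearMap.toSpanSingleton (ZMod m) _ (z ∘ e.symm)
  have hYinj : Function.Injective Y := fun c c' hc => by
    simpa [Y, hy] using congrFun hc (e i₀)
  have hZinj : Function.Injective Z := fun c c' hc => by
    simpa [Z, hz] using congrFun hc (e i₀)
  let E := LinearEquiv.ofInjective Y hYinj
  obtain ⟨π, u, -, hu⟩ := hE _ (LinearMap.range Y) (Z ∘ₗ E.symm.toLinearMap)
    (hZinj.comp E.symm.injective) (by
      intro c
      obtain ⟨c, rfl⟩ := E.surjective c
      have h1 := Equiv.sum_comp e.symm (fun i => w (c * z i))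
      have h2 := Equiv.sum_comp e.symm (fun i => w (c * y i))
      simpa [E, Y, Z] using h1.trans ((hyz c).trans h2.symm))
  refine ⟨(e.trans π).trans e.symm, u ∘ e, fun i => ?_⟩
  have := hu (E 1) (e i)
  simpa [E, Y, Z] using this

variable [NeZero m]

theorem addOrderOf_natCast_of_dvd {d : ℕ} (hd : d ∣ m) : addOrderOf (d : ZMod m) = m / d := by
  rw [ZMod.addOrderOf_coe _ (NeZero.ne m), Nat.gcd_eq_right hd]

theorem addOrderOf_dvd_modulus (x : ZMod m) : addOrderOf x ∣ m := by
  simpa using addOrderOf_dvd_card (x := x)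

theorem exists_divisor_mul_unit (x : ZMod m) :
    ∃ u : (ZMod m)ˣ, x = ((m / addOrderOf x : ℕ) : ZMod m) * u := by
  obtain ⟨d, hd, u, ⟨u, rfl⟩, hx⟩ := x.eq_unit_mul_divisor
  refine ⟨u, ?_⟩
  have : m / addOrderOf x = d := by
    rw [hx, mul_comm, addOrderOf_mul_unit, addOrderOf_natCast_of_dvd hd,
      Nat.div_div_self hd (NeZero.ne m)]
  rw [this, hx, mul_comm]

theorem exists_unit_mul_of_addOrderOf_eq {x y : ZMod m} (h : addOrderOf x = addOrderOf y) :
    ∃ u : (ZMod m)ˣ, x = y * u := by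
  obtain ⟨u, hu⟩ := exists_divisor_mul_unit x
  obtain ⟨v, hv⟩ := exists_divisor_mul_unit y
  refine ⟨v⁻¹ * u, ?_⟩
  rw [hu, h]
  nth_rw 2 [hv]
  simp [mul_assoc]

theorem exists_eq_mul_iff_addOrderOf_dvd {x y : ZMod m} :
    (∃ k, x = k * y) ↔ addOrderOf x ∣ addOrderOf y := by
  constructor
  · rintro ⟨k, rfl⟩
    rw [addOrderOf_dvd_iff_nsmul_eq_zero, ← mul_smul_comm, addOrderOf_nsmul_eq_zero, mul_zero]
  · intro h
    obtain ⟨u, hu⟩ := exists_divisor_mul_unit x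
    obtain ⟨v, hv⟩ := exists_divisor_mul_unit y
    obtain ⟨k, hk⟩ := Nat.div_dvd_div_left (addOrderOf_dvd_modulus y) h
    refine ⟨k * ↑v⁻¹ * u, ?_⟩
    rw [hk, Nat.cast_mul] at hu
    linear_combination hu - (k * ↑v⁻¹ * u) * hv
      - (k * u * ((m / addOrderOf y : ℕ) : ZMod m)) * v.inv_mul


section Character

variable {ψ : AddChar (ZMod m) ℂ}

theorem sum_addOrderOf_dvd (hψ : ψ.IsPrimitive) {d : ℕ} (hd : d ∣ m) :
    ∑ x : ZMod m with addOrderOf x ∣ d, ψ x = if d = 1 then 1 else 0 := by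
  split_ifs with h
  · subst h
    have : (univ.filter fun x : ZMod m => addOrderOf x ∣ 1) = {0} := by
      ext x
      simp
    rw [this, sum_singleton, AddChar.map_zero_eq_one]
  · set x₀ : ZMod m := ((m / d : ℕ) : ZMod m) with hx₀
    have hord : addOrderOf x₀ = d := by
      rw [addOrderOf_natCast_of_dvd (Nat.div_dvd_of_dvd hd), Nat.div_div_self hd (NeZero.ne m)]
    have hne : ψ x₀ ≠ 1 := by
      rw [Ne, hψ.zmod_char_eq_one_iff, ← AddMonoid.addOrderOf_eq_one_iff, hord]
      exact h
    have hshift : ∑ x : ZMod m with addOrderOf x ∣ d, ψ x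
        = ψ x₀ * ∑ x : ZMod m with addOrderOf x ∣ d, ψ x := by
      rw [mul_sum]
      refine sum_bij' (fun x _ => x - x₀) (fun x _ => x + x₀) ?_ ?_ ?_ ?_ ?_
      · simp only [mem_filter, mem_univ, true_and, addOrderOf_dvd_iff_nsmul_eq_zero]
        intro x hx
        rw [nsmul_sub, hx, ← hord, addOrderOf_nsmul_eq_zero, sub_zero]
      · simp only [mem_filter, mem_univ, true_and, addOrderOf_dvd_iff_nsmul_eq_zero]
        intro x hx
        rw [nsmul_add, hx, ← hord, addOrderOf_nsmul_eq_zero, add_zero]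
      · simp
      · simp
      · intro x _
        rw [← AddChar.map_add_eq_mul, add_sub_cancel]
    have : (ψ x₀ - 1) * ∑ x : ZMod m with addOrderOf x ∣ d, ψ x = 0 := by
      linear_combination -hshift
    exact (mul_eq_zero.mp this).resolve_left (sub_ne_zero.mpr hne)

theorem sum_addOrderOf_dvd_eq_sum_divisors (F : ZMod m → ℂ) {d : ℕ} (hd : d ∣ m) :
    ∑ x : ZMod m with addOrderOf x ∣ d, F x
      = ∑ e ∈ d.divisors, ∑ x : ZMod m with addOrderOf x = e, F x := by
  have hd0 : d ≠ 0 := ne_zero_of_dvd_ne_zero (NeZero.ne m) hd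
  rw [← sum_fiberwise_of_maps_to (s := univ.filter fun x : ZMod m => addOrderOf x ∣ d)
    (t := d.divisors) (g := addOrderOf) (by simp [hd0])]
  refine sum_congr rfl fun e he => sum_congr ?_ fun _ _ => rfl
  ext x
  simp only [mem_filter, mem_univ, true_and]
  constructor
  · exact fun h => h.2
  · exact fun h => ⟨h ▸ Nat.dvd_of_mem_divisors he, h⟩

theorem sum_divisors_moebius {R : Type*} [Ring R] (n : ℕ) :
    ∑ e ∈ n.divisors, (moebius e : R) = if n = 1 then 1 else 0 := by
  have h := congrArg (fun f : ArithmeticFunction R => f n)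
    (ArithmeticFunction.coe_moebius_mul_coe_zeta (R := R))
  simp only [ArithmeticFunction.coe_mul_zeta_apply, ArithmeticFunction.one_apply] at h
  simpa using h

/-- The Ramanujan sum of a primitive character at `1`. -/
theorem sum_addOrderOf_eq (hψ : ψ.IsPrimitive) (d : ℕ) (hd : d ∣ m) :
    ∑ x : ZMod m with addOrderOf x = d, ψ x = (moebius d : ℂ) := by
  induction d using Nat.strong_induction_on with
  | _ d ih =>
    have hd0 : d ≠ 0 := ne_zero_of_dvd_ne_zero (NeZero.ne m) hd
    have h := (sum_addOrderOf_dvd hψ hd).trans (sum_divisors_moebius (R := ℂ) d).symm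
    rw [sum_addOrderOf_dvd_eq_sum_divisors _ hd, ← Nat.cons_self_properDivisors hd0,
      sum_cons, sum_cons, sum_congr rfl fun e he => ih e (Nat.mem_properDivisors.mp he).2
        ((Nat.mem_properDivisors.mp he).1.trans hd)] at h
    exact add_right_cancel h

theorem sum_weight_mul_char (hψ : ψ.IsPrimitive) {w : ZMod m → ℚ}
    (hw : ∀ x y, addOrderOf x = addOrderOf y → w x = w y) {d : ℕ} (hd : d ∣ m) :
    ∑ x : ZMod m with addOrderOf x ∣ d, (w x : ℂ) * ψ x
      = ((∑ e ∈ d.divisors, w ((m / e : ℕ) : ZMod m) * (moebius e : ℚ) : ℚ) : ℂ) := by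
  rw [sum_addOrderOf_dvd_eq_sum_divisors _ hd]
  push_cast
  refine sum_congr rfl fun e he => ?_
  have hem : e ∣ m := (Nat.dvd_of_mem_divisors he).trans hd
  rw [← sum_addOrderOf_eq hψ e hem, mul_sum]
  refine sum_congr rfl fun x hx => ?_
  rw [hw x ((m / e : ℕ) : ZMod m)]
  rw [addOrderOf_natCast_of_dvd (Nat.div_dvd_of_dvd hem), Nat.div_div_self hem (NeZero.ne m)]
  simpa using hx

end Character

theorem sum_divisors_radical (g : ℕ → ℚ) {d : ℕ} (hd : d ≠ 0) :
    ∑ e ∈ d.divisors, g e * (moebius e : ℚ)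
      = ∑ e ∈ (UniqueFactorizationMonoid.radical d).divisors, g e * (moebius e : ℚ) := by
  symm
  refine sum_subset (Nat.divisors_subset_of_dvd hd UniqueFactorizationMonoid.radical_dvd_self) ?_
  intro e he hne
  have : ¬ Squarefree e := fun h => hne <| by
    rw [Nat.mem_divisors]
    exact ⟨(UniqueFactorizationMonoid.dvd_radical_iff h.isRadical hd).mpr
      (Nat.dvd_of_mem_divisors he), UniqueFactorizationMonoid.radical_ne_zero⟩
  simp [ArithmeticFunction.moebius_eq_zero_of_not_squarefree this]

theorem moebius_div {r s : ℕ} (hr : Squarefree r) (hs : s ∣ r) :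
    moebius (r / s) = moebius r * moebius s := by
  obtain ⟨t, rfl⟩ := hs
  have hs0 : 0 < s := Nat.pos_of_ne_zero fun h => by simp [h] at hr
  have hst := (Nat.squarefree_mul_iff.mp hr)
  rw [Nat.mul_div_cancel_left _ hs0,
    ArithmeticFunction.isMultiplicative_moebius.map_mul_of_coprime hst.1, mul_right_comm, ← sq,
    ArithmeticFunction.moebius_sq_eq_one_of_squarefree hst.2.1, one_mul]

theorem sum_divisors_ne_zero {w : ZMod m → ℚ}
    (h : ∀ a : ℕ, 0 < a → a ∣ m → 1 < m / a → Squarefree (m / a) →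
        ∑ s ∈ (m / a).divisors,
          w ((s * a : ℕ) : ZMod m) * ((moebius s : ℤ) : ℚ) ≠ 0)
    {d : ℕ} (hd : d ∣ m) (hd1 : 1 < d) :
    ∑ e ∈ d.divisors, w ((m / e : ℕ) : ZMod m) * (moebius e : ℚ) ≠ 0 := by
  rw [sum_divisors_radical (fun e => w ((m / e : ℕ) : ZMod m)) (by omega)]
  set r := UniqueFactorizationMonoid.radical d with hr
  have hrm : r ∣ m := UniqueFactorizationMonoid.radical_dvd_self.trans hd
  have hsq : Squarefree r := UniqueFactorizationMonoid.squarefree_radical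
  have hmr : m / (m / r) = r := Nat.div_div_self hrm (NeZero.ne m)
  have hr1 : 1 < r := Nat.one_lt_radical_iff.mpr hd1
  have key := h (m / r) (Nat.div_pos (Nat.le_of_dvd (NeZero.pos m) hrm) (by omega))
    (Nat.div_dvd_of_dvd hrm) (by rwa [hmr]) (by rwa [hmr])
  rw [hmr] at key
  rw [← Nat.sum_div_divisors]
  have hμ : (moebius r : ℚ) ≠ 0 :=
    Int.cast_ne_zero.mpr (ArithmeticFunction.moebius_ne_zero_iff_squarefree.mpr hsq)
  convert mul_ne_zero hμ key using 1
  rw [mul_sum]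
  refine sum_congr rfl fun s hs => ?_
  have hsr := Nat.dvd_of_mem_divisors hs
  have : m / (r / s) = s * (m / r) := by
    obtain ⟨t, ht⟩ := hsr
    obtain ⟨k, hk⟩ := hrm
    have hs0 : 0 < s := Nat.pos_of_mem_divisors hs
    have ht0 : 0 < t := Nat.pos_of_ne_zero fun h => by simp [h] at ht; omega
    rw [hk, Nat.mul_div_cancel_left _ (by omega : 0 < r), ht, Nat.mul_div_cancel_left _ hs0,
      mul_right_comm, Nat.mul_div_cancel _ ht0]
  rw [this, moebius_div hsq hsr]
  push_cast
  ring

section Functional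

variable {M : Type*} [AddCommGroup M] [Module (ZMod m) M]

theorem mem_range_iff_addOrderOf_dvd {f : M →ₗ[ZMod m] ZMod m} {c₀ : M}
    (hc₀ : ∀ c, ∃ k, f c = k * f c₀) (x : ZMod m) :
    x ∈ Set.range f ↔ addOrderOf x ∣ addOrderOf (f c₀) := by
  rw [← exists_eq_mul_iff_addOrderOf_dvd]
  constructor
  · rintro ⟨c, rfl⟩
    exact hc₀ c
  · rintro ⟨k, rfl⟩
    exact ⟨k • c₀, by simp⟩

theorem exists_unit_mul_of_ker_eq {f g : M →ₗ[ZMod m] ZMod m}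
    (h : LinearMap.ker f = LinearMap.ker g) : ∃ u : (ZMod m)ˣ, ∀ c, f c = g c * u := by
  have hk : ∀ c, f c = 0 ↔ g c = 0 := fun c => by
    rw [← LinearMap.mem_ker, h, LinearMap.mem_ker]
  obtain ⟨c₀, hc₀⟩ := exists_generator_of_range f
  have hord : addOrderOf (f c₀) = addOrderOf (g c₀) := by
    refine Nat.dvd_antisymm ?_ ?_
    · rw [addOrderOf_dvd_iff_nsmul_eq_zero, ← map_nsmul, hk, map_nsmul, addOrderOf_nsmul_eq_zero]
    · rw [addOrderOf_dvd_iff_nsmul_eq_zero, ← map_nsmul, ← hk, map_nsmul,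
        addOrderOf_nsmul_eq_zero]
  obtain ⟨u, hu⟩ := exists_unit_mul_of_addOrderOf_eq hord
  refine ⟨u, fun c => ?_⟩
  obtain ⟨k, hkc⟩ := hc₀ c
  have hz : g (c - k • c₀) = 0 := (hk _).mp (by simp [hkc])
  have hg : g c = k * g c₀ := by simpa [sub_eq_zero] using hz
  rw [hkc, hg, hu, mul_assoc]

variable [Fintype M] {w : ZMod m → ℚ} {ψ : AddChar (ZMod m) ℂ}

theorem sum_comp_eq_card_mul (f : M →ₗ[ZMod m] ZMod m) {c₀ : M}
    (hc₀ : ∀ c, ∃ k, f c = k * f c₀) (F : ZMod m → ℂ) :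
    ∑ c, F (f c) = (univ.filter fun c => f c = 0).card
      * ∑ x : ZMod m with addOrderOf x ∣ addOrderOf (f c₀), F x := by
  rw [mul_sum, ← sum_fiberwise_of_maps_to
    (t := univ.filter fun x : ZMod m => addOrderOf x ∣ addOrderOf (f c₀)) (g := f)]
  · refine sum_congr rfl fun x hx => ?_
    rw [mem_filter, ← mem_range_iff_addOrderOf_dvd hc₀] at hx
    rw [AddMonoidHom.card_fiber_eq_of_mem_range f (x := 0) ⟨0, map_zero f⟩ hx.2,
      ← nsmul_eq_mul, ← sum_const]
    refine sum_congr rfl fun c hc => ?_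
    rw [(mem_filter.mp hc).2]
  · intro c _
    simpa using (mem_range_iff_addOrderOf_dvd hc₀ (f c)).mp ⟨c, rfl⟩

theorem sum_weight_mul_char_self_ne_zero (hψ : ψ.IsPrimitive)
    (hw : ∀ x y, addOrderOf x = addOrderOf y → w x = w y)
    (h : ∀ a : ℕ, 0 < a → a ∣ m → 1 < m / a → Squarefree (m / a) →
        ∑ s ∈ (m / a).divisors,
          w ((s * a : ℕ) : ZMod m) * ((moebius s : ℤ) : ℚ) ≠ 0)
    {f : M →ₗ[ZMod m] ZMod m} (hf : LinearMap.ker f ≠ ⊤) :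
    ∑ c, (w (f c) : ℂ) * ψ (f c) ≠ 0 := by
  obtain ⟨c₀, hc₀⟩ := exists_generator_of_range f
  rw [sum_comp_eq_card_mul f hc₀ (fun x => (w x : ℂ) * ψ x),
    sum_weight_mul_char hψ hw (addOrderOf_dvd_modulus _)]
  have hcard : (univ.filter fun c => f c = 0).card ≠ 0 :=
    card_ne_zero_of_mem (a := 0) (by simp)
  refine mul_ne_zero (Nat.cast_ne_zero.mpr hcard) (Rat.cast_ne_zero.mpr
    (sum_divisors_ne_zero h (addOrderOf_dvd_modulus _) ?_))
  have hpos := addOrderOf_pos (f c₀)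
  have hne : addOrderOf (f c₀) ≠ 1 := fun h1 => hf <| by
    rw [AddMonoid.addOrderOf_eq_one_iff] at h1
    refine LinearMap.ker_eq_top.mpr (LinearMap.ext fun c => ?_)
    obtain ⟨k, hk⟩ := hc₀ c
    rw [hk, h1, mul_zero, LinearMap.zero_apply]
  omega

theorem sum_weight_mul_char_eq_zero (hψ : ψ.IsPrimitive) {f g : M →ₗ[ZMod m] ZMod m}
    (hfg : ¬ LinearMap.ker g ≤ LinearMap.ker f) :
    ∑ c, (w (g c) : ℂ) * ψ (f c) = 0 := by
  obtain ⟨b, hb, hfb⟩ := SetLike.not_le_iff_exists.mp hfg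
  rw [LinearMap.mem_ker] at hb hfb
  have hne : ψ (f b) ≠ 1 := by rwa [Ne, hψ.zmod_char_eq_one_iff]
  have hshift : ∑ c, (w (g c) : ℂ) * ψ (f c) = ψ (f b) * ∑ c, (w (g c) : ℂ) * ψ (f c) := by
    rw [mul_sum]
    refine (Fintype.sum_equiv (Equiv.addLeft b) _ _ fun c => ?_).symm
    simp only [Equiv.coe_addLeft, map_add, hb, zero_add, AddChar.map_add_eq_mul]
    ring
  have : (ψ (f b) - 1) * ∑ c, (w (g c) : ℂ) * ψ (f c) = 0 := by
    linear_combination -hshift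
  exact (mul_eq_zero.mp this).resolve_left (sub_ne_zero.mpr hne)

/-- In a linear relation between the weight functions of functionals whose coefficients add up to
zero, the coefficients already add up to zero over functionals with a common kernel. -/
theorem sum_coeff_ker_eq_zero
    (hw : ∀ x y, addOrderOf x = addOrderOf y → w x = w y)
    (h : ∀ a : ℕ, 0 < a → a ∣ m → 1 < m / a → Squarefree (m / a) →
        ∑ s ∈ (m / a).divisors,
          w ((s * a : ℕ) : ZMod m) * ((moebius s : ℤ) : ℚ) ≠ 0)
    {ι : Type*} [Fintype ι] (ε : ι → ℚ) (f : ι → M →ₗ[ZMod m] ZMod m)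
    [DecidableEq (Submodule (ZMod m) M)]
    (hε : ∑ j, ε j = 0) (hrel : ∀ c, ∑ j, ε j * w (f j c) = 0) (K : Submodule (ZMod m) M) :
    ∑ j with LinearMap.ker (f j) = K, ε j = 0 := by
  have : Finite (Submodule (ZMod m) M) := Finite.of_injective _ SetLike.coe_injective
  have := Fintype.ofFinite (Submodule (ZMod m) M)
  induction K using WellFoundedLT.induction with
  | _ K ih =>
    by_cases hK : K = ⊤
    · rw [← sum_fiberwise _ (fun j => LinearMap.ker (f j)),
        sum_eq_single_of_mem K (mem_univ _)] at hε
      · exact hε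
      · intro K' _ hne
        subst hK
        exact ih K' hne.lt_top
    by_cases hex : ∃ j₀, LinearMap.ker (f j₀) = K
    · obtain ⟨j₀, rfl⟩ := hex
      have hψ := ZMod.isPrimitive_stdAddChar m
      set ψ : AddChar (ZMod m) ℂ := ZMod.stdAddChar
      set T : (M →ₗ[ZMod m] ZMod m) → ℂ := fun g => ∑ c, (w (g c) : ℂ) * ψ (f j₀ c) with hT
      have hTker : ∀ g g', LinearMap.ker g = LinearMap.ker g' → T g = T g' := by
        intro g g' hgg
        obtain ⟨u, hu⟩ := exists_unit_mul_of_ker_eq hgg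
        refine sum_congr rfl fun c _ => ?_
        rw [hw (g c) (g' c) (by rw [hu, addOrderOf_mul_unit])]
      have hfiber : ∀ j₁, ∑ j with LinearMap.ker (f j) = LinearMap.ker (f j₁), (ε j : ℂ) * T (f j)
          = ((∑ j with LinearMap.ker (f j) = LinearMap.ker (f j₁), ε j : ℚ) : ℂ) * T (f j₁) := by
        intro j₁
        push_cast
        rw [sum_mul]
        refine sum_congr rfl fun j hj => ?_
        rw [hTker _ _ (mem_filter.mp hj).2]
      have hsum : ∑ j, (ε j : ℂ) * T (f j) = 0 := by
        simp only [hT, mul_sum]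
        rw [sum_comm]
        refine sum_eq_zero fun c _ => ?_
        have := congrArg (fun q : ℚ => (q : ℂ) * ψ (f j₀ c)) (hrel c)
        simp only [Rat.cast_sum, Rat.cast_mul, sum_mul, Rat.cast_zero, zero_mul] at this
        simpa only [mul_assoc] using this
      rw [← sum_fiberwise _ (fun j => LinearMap.ker (f j)),
        sum_eq_single_of_mem (LinearMap.ker (f j₀)) (mem_univ _), hfiber] at hsum
      · exact_mod_cast (mul_eq_zero.mp hsum).resolve_right
          (sum_weight_mul_char_self_ne_zero hψ hw h hK)
      · intro K' _ hne
        by_cases hex' : ∃ j₁, LinearMap.ker (f j₁) = K'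
        · obtain ⟨j₁, rfl⟩ := hex'
          by_cases hle : LinearMap.ker (f j₁) ≤ LinearMap.ker (f j₀)
          · rw [hfiber, ih _ (lt_of_le_of_ne hle hne), Rat.cast_zero, zero_mul]
          · rw [hfiber, hT]
            simp only
            rw [sum_weight_mul_char_eq_zero hψ hle, mul_zero]
        · push Not at hex'
          exact sum_eq_zero fun j hj => absurd (mem_filter.mp hj).2 (hex' j)
    · push Not at hex
      exact sum_eq_zero fun j hj => absurd (mem_filter.mp hj).2 (hex j)

end Functional

theorem extensionProperty_of_sum_ne_zero {w : ZMod m → ℚ}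
    (hw : ∀ x y, addOrderOf x = addOrderOf y → w x = w y)
    (h : ∀ a : ℕ, 0 < a → a ∣ m → 1 < m / a → Squarefree (m / a) →
        ∑ s ∈ (m / a).divisors,
          w ((s * a : ℕ) : ZMod m) * ((moebius s : ℤ) : ℚ) ≠ 0) :
    ExtensionProperty (ZMod m) w := by
  classical
  intro n C φ _ hiso
  have := Fintype.ofFinite C
  let L : Fin n → C →ₗ[ZMod m] ZMod m := fun i => LinearMap.proj i ∘ₗ C.subtype
  let P : Fin n → C →ₗ[ZMod m] ZMod m := fun i => LinearMap.proj i ∘ₗ φ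
  have hcount : ∀ K, Fintype.card {i // LinearMap.ker (P i) = K}
      = Fintype.card {i // LinearMap.ker (L i) = K} := by
    intro K
    have hrel := sum_coeff_ker_eq_zero (M := C) hw h
      (Sum.elim (fun _ : Fin n => (1 : ℚ)) (fun _ : Fin n => (-1 : ℚ))) (Sum.elim P L)
      (by simp) (fun c => by simpa [L, P, sub_eq_zero, ← sub_eq_add_neg] using hiso c) K
    rw [sum_filter, Fintype.sum_sum_type] at hrel
    have hsum : ∑ i, (if LinearMap.ker (P i) = K then (1 : ℚ) else 0)
        + ∑ i, (if LinearMap.ker (L i) = K then (-1 : ℚ) else 0) = 0 := hrel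
    rw [← sum_filter, ← sum_filter, sum_const, sum_const, nsmul_eq_mul, nsmul_eq_mul, mul_one,
      mul_neg, mul_one, ← sub_eq_add_neg, sub_eq_zero, Nat.cast_inj] at hsum
    rw [Fintype.card_subtype, Fintype.card_subtype, hsum]
  let π : Equiv.Perm (Fin n) := Equiv.ofFiberEquiv
    (f := fun i => LinearMap.ker (P i)) (g := fun i => LinearMap.ker (L i))
    fun K => Fintype.equivOfCardEq (hcount K)
  have hπ : ∀ i, LinearMap.ker (P i) = LinearMap.ker (L (π i)) := fun i =>
    (Equiv.ofFiberEquiv_map (f := fun i => LinearMap.ker (P i))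
      (g := fun i => LinearMap.ker (L i)) _ i).symm
  choose u hu using fun i => exists_unit_mul_of_ker_eq (hπ i)
  exact ⟨π, u, fun i x => hw _ _ (addOrderOf_mul_unit x (u i)), fun c i => hu i c⟩

/-- Splitting the divisors of `p * n` by divisibility by a prime `p` not dividing `n`. -/
theorem sum_divisors_prime_mul {R : Type*} [AddCommMonoid R] {p n : ℕ} (hp : p.Prime)
    (hpn : ¬ p ∣ n) (g : ℕ → R) :
    ∑ s ∈ (p * n).divisors, g s = ∑ t ∈ n.divisors, (g t + g (p * t)) := by
  have hn : n ≠ 0 := fun h => hpn (h ▸ dvd_zero p)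
  have hunion : (p * n).divisors = n.divisors ∪ n.divisors.image (p * ·) := by
    ext s
    simp only [mem_union, mem_image, Nat.mem_divisors, mul_ne_zero hp.ne_zero hn, hn, ne_eq,
      not_false_eq_true, and_true]
    constructor
    · intro hs
      by_cases hps : p ∣ s
      · obtain ⟨t, rfl⟩ := hps
        exact Or.inr ⟨t, Nat.dvd_of_mul_dvd_mul_left hp.pos hs, rfl⟩
      · exact Or.inl (((Nat.Prime.coprime_iff_not_dvd hp).mpr hps).symm.dvd_of_dvd_mul_left hs)
    · rintro (hs | ⟨t, ht, rfl⟩)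
      · exact hs.mul_left p
      · exact Nat.mul_dvd_mul_left p ht
  rw [hunion, sum_union, sum_image, sum_add_distrib]
  · exact fun a _ b _ hab => Nat.eq_of_mul_eq_mul_left hp.pos hab
  · rw [disjoint_left]
    intro s hs hs'
    obtain ⟨t, _, rfl⟩ := mem_image.mp hs'
    exact hpn ((Dvd.intro t rfl).trans (Nat.dvd_of_mem_divisors hs))

theorem moebius_prime_mul {p t : ℕ} (hp : p.Prime) (hpt : ¬ p ∣ t) :
    moebius (p * t) = -moebius t := by
  rw [ArithmeticFunction.isMultiplicative_moebius.map_mul_of_coprime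
    ((Nat.Prime.coprime_iff_not_dvd hp).mpr hpt), ArithmeticFunction.moebius_apply_prime hp]
  ring

theorem addOrderOf_nsmul_eq_div {r s : ℕ} {b : ZMod m} (hb : addOrderOf b = r)
    (hs : s ∣ r) : addOrderOf (s • b) = r / s := by
  have hs0 : s ≠ 0 := ne_zero_of_dvd_ne_zero (hb ▸ (addOrderOf_pos b).ne') hs
  rw [addOrderOf_nsmul_of_dvd hs0 (hb ▸ hs), hb]

theorem sum_moebius_weight_nsmul_eq_zero {w : ZMod m → ℚ}
    (hw : ∀ x y, addOrderOf x = addOrderOf y → w x = w y) {r : ℕ} (hr : Squarefree r)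
    {a b : ZMod m} (ha : addOrderOf a = r) (hb : addOrderOf b ∣ r)
    (h : ∑ s ∈ r.divisors, (moebius s : ℚ) * w (s • a) = 0) :
    ∑ s ∈ r.divisors, (moebius s : ℚ) * w (s • b) = 0 := by
  by_cases hbr : addOrderOf b = r
  · rw [← h]
    refine sum_congr rfl fun s hs => ?_
    have hsr := Nat.dvd_of_mem_divisors hs
    rw [hw (s • b) (s • a) (by
      rw [addOrderOf_nsmul_eq_div ha hsr, addOrderOf_nsmul_eq_div hbr hsr])]
  · obtain ⟨k, hk⟩ := hb
    have hk1 : k ≠ 1 := fun h1 => hbr (by rw [hk, h1, mul_one])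
    obtain ⟨q, hq, l, rfl⟩ := Nat.exists_prime_and_dvd hk1
    have hr' : r = q * (addOrderOf b * l) := by rw [hk]; ring
    have hcop := (Nat.squarefree_mul_iff.mp (hr' ▸ hr)).1
    have hql : ¬ q ∣ addOrderOf b * l := (Nat.Prime.coprime_iff_not_dvd hq).mp hcop
    rw [hr', sum_divisors_prime_mul hq hql]
    refine sum_eq_zero fun t ht => ?_
    have hqt : ¬ q ∣ t := fun h' => hql (h'.trans (Nat.dvd_of_mem_divisors ht))
    have hord : addOrderOf ((q * t) • b) = addOrderOf (t • b) := by
      rw [mul_smul]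
      refine Nat.Coprime.addOrderOf_nsmul (Nat.Coprime.coprime_dvd_left (k := addOrderOf b)
        (addOrderOf_dvd_of_nsmul_eq_zero ?_) ?_)
      · rw [nsmul_left_comm, addOrderOf_nsmul_eq_zero, nsmul_zero]
      · exact (Nat.Coprime.coprime_mul_right_right hcop).symm
    rw [moebius_prime_mul hq hqt, hw _ _ hord]
    push_cast
    ring

theorem sum_ne_zero_of_extensionProperty {w : ZMod m → ℚ}
    (hw : ∀ x y, addOrderOf x = addOrderOf y → w x = w y)
    (hE : ExtensionProperty (ZMod m) w) {a : ℕ} (ha : a ∣ m) (h1 : 1 < m / a)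
    (hsq : Squarefree (m / a)) :
    ∑ s ∈ (m / a).divisors, w ((s * a : ℕ) : ZMod m) * ((moebius s : ℤ) : ℚ) ≠ 0 := by
  intro hzero
  have hord : addOrderOf (a : ZMod m) = m / a := addOrderOf_natCast_of_dvd ha
  set r := m / a with hr
  obtain ⟨p, hp, n, hpn⟩ := Nat.exists_prime_and_dvd (by omega : r ≠ 1)
  have hcop := (Nat.squarefree_mul_iff.mp (hpn ▸ hsq))
  have hpn' : ¬ p ∣ n := (Nat.Prime.coprime_iff_not_dvd hp).mp hcop.1
  have hrel : ∑ s ∈ r.divisors, (moebius s : ℚ) * w (s • (a : ZMod m)) = 0 := by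
    rw [← hzero]
    refine sum_congr rfl fun s _ => ?_
    rw [nsmul_eq_mul, Nat.cast_mul, mul_comm]
  let y : Option n.divisors → ZMod m := fun i =>
    i.elim 1 fun t => if moebius (t : ℕ) = 1 then (t : ℕ) • (a : ZMod m)
      else (p * t : ℕ) • (a : ZMod m)
  let z : Option n.divisors → ZMod m := fun i =>
    i.elim 1 fun t => if moebius (t : ℕ) = 1 then (p * t : ℕ) • (a : ZMod m)
      else (t : ℕ) • (a : ZMod m)
  have hyz : ∀ c, ∑ i, w (c * z i) = ∑ i, w (c * y i) := by
    intro c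
    have hc : addOrderOf (c * a) ∣ r := hord ▸ exists_eq_mul_iff_addOrderOf_dvd.mp ⟨c, rfl⟩
    have key := sum_moebius_weight_nsmul_eq_zero hw hsq hord hc hrel
    rw [hpn, sum_divisors_prime_mul hp hpn', ← sum_coe_sort] at key
    rw [Fintype.sum_option, Fintype.sum_option]
    congr 1
    rw [eq_comm, ← sub_eq_zero, ← sum_sub_distrib, ← key]
    refine sum_congr rfl fun t _ => ?_
    have htn := Nat.dvd_of_mem_divisors t.2
    have hpt : ¬ p ∣ (t : ℕ) := fun h' => hpn' (h'.trans htn)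
    rw [moebius_prime_mul hp hpt]
    rcases ArithmeticFunction.moebius_ne_zero_iff_eq_or.mp
      (ArithmeticFunction.moebius_ne_zero_iff_squarefree.mpr (hcop.2.2.squarefree_of_dvd htn))
      with hμ | hμ
    · simp only [y, z, Option.elim_some, hμ, if_true, mul_smul_comm]
      push_cast
      ring
    · have hne : (-1 : ℤ) ≠ 1 := by norm_num
      simp only [y, z, Option.elim_some, hμ, hne, if_false, mul_smul_comm]
      push_cast
      ring
  obtain ⟨π, u, hu⟩ := exists_perm_of_generators hE y z none rfl rfl hyz
  have hcount : ∑ i, (if addOrderOf (z i) = r then 1 else 0)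
      = ∑ i, (if addOrderOf (y i) = r then 1 else 0) := by
    rw [← Equiv.sum_comp π fun i => if addOrderOf (y i) = r then 1 else 0]
    refine sum_congr rfl fun i _ => ?_
    rw [hu i, addOrderOf_mul_unit]
  have hrpos : 0 < r := by omega
  have hlt : ∀ s : ℕ, s ∣ r → s ≠ 1 → addOrderOf (s • (a : ZMod m)) ≠ r := by
    intro s hs hs1
    have hs0 : s ≠ 0 := ne_zero_of_dvd_ne_zero hrpos.ne' hs
    rw [addOrderOf_nsmul_eq_div hord hs]
    exact (Nat.div_lt_self hrpos (by omega)).ne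
  refine absurd hcount (ne_of_lt (sum_lt_sum (fun i _ => ?_)
    ⟨some ⟨1, by simp [(hcop.2.2).ne_zero]⟩, mem_univ _, ?_⟩))
  · rcases i with _ | t
    · rfl
    · have htr : (p * t : ℕ) ∣ r := hpn ▸ Nat.mul_dvd_mul_left p (Nat.dvd_of_mem_divisors t.2)
      have hpt : (p * t : ℕ) ≠ 1 := fun h' => hp.ne_one (Nat.eq_one_of_mul_eq_one_right h')
      by_cases hμ : moebius (t : ℕ) = 1
      · simp only [z, Option.elim_some, hμ, if_true, hlt _ htr hpt, if_false]
        exact Nat.zero_le _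
      · have ht1 : (t : ℕ) ≠ 1 := fun h' => hμ (by rw [h', ArithmeticFunction.moebius_apply_one])
        have htr' : (t : ℕ) ∣ r := (Dvd.intro_left p rfl).trans htr
        simp only [z, Option.elim_some, hμ, if_false, hlt _ htr' ht1]
        exact Nat.zero_le _
  · have hpr : p ∣ r := hpn ▸ Dvd.intro n rfl
    simp only [y, z, Option.elim_some, ArithmeticFunction.moebius_apply_one, if_true, one_smul,
      mul_one, hord, hlt p hpr hp.ne_one, if_false, zero_lt_one]

end ZModWeight

/-- an invariant weight `w` on `ℤ/mℤ` (`m ≥ 2`) satisfies the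
Extension Property iff for every positive divisor `a` of `m` with `m/a > 1`
squarefree, `∑_{s ∣ m/a} w(s·a)·μ(s) ≠ 0`, `μ` the number-theoretic Möbius
function. -/
theorem stmt12 (m : ℕ) (hm : 2 ≤ m) (w : ZMod m → ℚ)
    (hinv : ∀ (u : (ZMod m)ˣ) (x : ZMod m), w ((u : ZMod m) * x) = w x) :
    ExtensionProperty (ZMod m) w ↔
      ∀ a : ℕ, 0 < a → a ∣ m → 1 < m / a → Squarefree (m / a) →
        ∑ s ∈ (m / a).divisors,
          w ((s * a : ℕ) : ZMod m) * ((ArithmeticFunction.moebius s : ℤ) : ℚ) ≠ 0 := by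
  have : NeZero m := ⟨by omega⟩
  have hw : ∀ x y, addOrderOf x = addOrderOf y → w x = w y := by
    intro x y hxy
    obtain ⟨u, rfl⟩ := ZModWeight.exists_unit_mul_of_addOrderOf_eq hxy
    rw [mul_comm, hinv]
  exact ⟨fun hE a _ ha h1 hsq => ZModWeight.sum_ne_zero_of_extensionProperty hw hE ha h1 hsq,
    ZModWeight.extensionProperty_of_sum_ne_zero hw⟩
end

section
/- Let F be a finite field and n ≥ 1, and let R = Matₙ(F) be the ring of n×n matrices over F. Define the rank weight w : R → ℚ by w(A) = rank(A). Then w is bi-invariant and (R, w) satisfies the Extension Property. -/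
section Subspaces

open scoped Classical

variable {F V W ι : Type*} [Field F] [AddCommGroup V] [Module F V] [AddCommGroup W] [Module F W]

theorem mem_sup_span_singleton_iff (K : Submodule F V) (x v : V) :
    x ∈ K ⊔ Submodule.span F {v} ↔ ∃ a : F, x - a • v ∈ K := by
  simp only [Submodule.mem_sup, Submodule.mem_span_singleton]
  constructor
  · rintro ⟨y, hy, z, ⟨a, rfl⟩, rfl⟩
    exact ⟨a, by simpa using hy⟩
  · rintro ⟨a, ha⟩
    exact ⟨_, ha, _, ⟨a, rfl⟩, by simp⟩

/-- Counting the translates of a family along `v` that lie in `K`. -/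
theorem sum_indicator_translates [Fintype F] {t : ℕ} (K : Submodule F V) (T : Fin t → V) (v : V) :
    ∑ a : Fin t → F, (if ∀ j, T j - a j • v ∈ K then (1 : ℚ) else 0) =
      (if ∀ j, T j ∈ K ⊔ Submodule.span F {v} then 1 else 0) +
        ((Fintype.card F : ℚ) ^ t - 1) * (if v ∈ K ∧ ∀ j, T j ∈ K then 1 else 0) := by
  by_cases hv : v ∈ K
  · have h1 : ∀ (a : Fin t → F) j, T j - a j • v ∈ K ↔ T j ∈ K := fun a j =>
      K.sub_mem_iff_left (K.smul_mem _ hv)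
    have h2 : K ⊔ Submodule.span F {v} = K := by simpa using hv
    simp only [h1, h2, hv, true_and]
    split_ifs <;> simp
  · simp only [hv, false_and, if_false, mul_zero, add_zero]
    split_ifs with h
    · simp only [mem_sup_span_singleton_iff] at h
      choose b hb using h
      have huniq : ∀ a : Fin t → F, (∀ j, T j - a j • v ∈ K) ↔ a = b := by
        refine fun a => ⟨fun ha => funext fun j => ?_, fun h => h ▸ hb⟩
        by_contra hne
        have hmem : (a j - b j) • v ∈ K := by
          have := K.sub_mem (hb j) (ha j)
          rwa [sub_sub_sub_cancel_left, ← sub_smul] at this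
        exact hv ((K.smul_mem_iff (sub_ne_zero.2 hne)).1 hmem)
      simp [huniq]
    · refine Finset.sum_eq_zero fun a _ => if_neg fun ha => h fun j => ?_
      exact (mem_sup_span_singleton_iff _ _ _).2 ⟨a j, ha j⟩

theorem sum_indicator_family_mem_eq [Fintype F] [Fintype ι] (K L : ι → Submodule F V)
    (h : ∀ (B : Submodule F V) (v : V),
      ∑ i, (if v ∈ K i ⊔ B then (1 : ℚ) else 0) = ∑ i, (if v ∈ L i ⊔ B then (1 : ℚ) else 0))
    (t : ℕ) (T : Fin t → V) (B : Submodule F V) :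
    ∑ i, (if ∀ j, T j ∈ K i ⊔ B then (1 : ℚ) else 0) =
      ∑ i, (if ∀ j, T j ∈ L i ⊔ B then (1 : ℚ) else 0) := by
  induction t generalizing B with
  | zero => simp
  | succ t ih =>
    rcases Nat.eq_zero_or_pos t with rfl | ht
    · simpa [Fin.forall_fin_one] using h B (T 0)
    have key : ∀ M : ι → Submodule F V,
        ((Fintype.card F : ℚ) ^ t - 1) * ∑ i, (if ∀ j, T j ∈ M i ⊔ B then (1 : ℚ) else 0) =
          ∑ a : Fin t → F, ∑ i, (if ∀ j : Fin t, T j.succ - a j • T 0 ∈ M i ⊔ B then (1 : ℚ) else 0)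
          - ∑ i, (if ∀ j : Fin t, T j.succ ∈ M i ⊔ (B ⊔ Submodule.span F {T 0})
              then (1 : ℚ) else 0) := by
      intro M
      rw [Finset.sum_comm, ← Finset.sum_sub_distrib, Finset.mul_sum]
      refine Finset.sum_congr rfl fun i _ => ?_
      rw [sum_indicator_translates (M i ⊔ B) (fun j : Fin t => T j.succ) (T 0), ← sup_assoc]
      simp only [Fin.forall_fin_succ]
      ring
    have hq : (Fintype.card F : ℚ) ^ t - 1 ≠ 0 := by
      have : (1 : ℚ) < Fintype.card F := by exact_mod_cast Fintype.one_lt_card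
      exact (sub_pos.2 (one_lt_pow₀ this ht.ne')).ne'
    refine mul_left_cancel₀ hq ?_
    rw [key K, key L]
    congr 1
    · exact Finset.sum_congr rfl fun a _ => ih _ B
    · exact ih _ _

theorem finrank_map_sup_span_singleton [FiniteDimensional F W] (f : V →ₗ[F] W)
    (B : Submodule F V) (v : V) :
    (Module.finrank F ((B ⊔ Submodule.span F {v}).map f) : ℚ) =
      Module.finrank F (B.map f) + 1 - (if v ∈ LinearMap.ker f ⊔ B then 1 else 0) := by
  have hmem : v ∈ LinearMap.ker f ⊔ B ↔ f v ∈ B.map f := by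
    rw [sup_comm, ← Submodule.comap_map_eq, Submodule.mem_comap]
  rw [hmem, Submodule.map_sup, Submodule.map_span, Set.image_singleton]
  split_ifs with hv
  · rw [sup_eq_left.2 (by simpa using hv)]
    simp
  · rw [Submodule.finrank_sup_span_singleton hv]
    simp

/-- If two families of linear maps have the same total rank on every subspace, then they have
the same number of zero members. -/
theorem sum_indicator_eq_zero_eq_of_sum_finrank_map [Fintype F] [Fintype ι]
    [FiniteDimensional F V] [FiniteDimensional F W] (f g : ι → V →ₗ[F] W)
    (h : ∀ B : Submodule F V,
      ∑ i, (Module.finrank F (B.map (f i)) : ℚ) = ∑ i, (Module.finrank F (B.map (g i)) : ℚ)) :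
    ∑ i, (if f i = 0 then (1 : ℚ) else 0) = ∑ i, (if g i = 0 then (1 : ℚ) else 0) := by
  have hker : ∀ (B : Submodule F V) (v : V),
      ∑ i, (if v ∈ LinearMap.ker (f i) ⊔ B then (1 : ℚ) else 0) =
        ∑ i, (if v ∈ LinearMap.ker (g i) ⊔ B then (1 : ℚ) else 0) := by
    intro B v
    have h' := h (B ⊔ Submodule.span F {v})
    simp only [finrank_map_sup_span_singleton, Finset.sum_sub_distrib, Finset.sum_add_distrib,
      h B] at h'
    linarith
  have hzero : ∀ e : V →ₗ[F] W,
      e = 0 ↔ ∀ j, Module.finBasis F V j ∈ LinearMap.ker e ⊔ (⊥ : Submodule F V) := by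
    intro e
    simp only [sup_bot_eq, LinearMap.mem_ker]
    exact ⟨fun he j => by simp [he], fun he => (Module.finBasis F V).ext (by simpa using he)⟩
  simp only [hzero]
  exact sum_indicator_family_mem_eq _ _ hker _ _ _

theorem exists_linearEquiv_comp_eq_of_ker_eq [FiniteDimensional F W] (f g : V →ₗ[F] W)
    (h : LinearMap.ker f = LinearMap.ker g) :
    ∃ e : W ≃ₗ[F] W, ∀ x, g x = e (f x) := by
  let k : LinearMap.range f ≃ₗ[F] LinearMap.range g :=
    f.quotKerEquivRange.symm ≪≫ₗ Submodule.quotEquivOfEq _ _ h ≪≫ₗ g.quotKerEquivRange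
  obtain ⟨e, he⟩ := Submodule.exists_linearEquiv_restrict_eq k
  refine ⟨e, fun x => ?_⟩
  have hk : k ⟨f x, x, rfl⟩ = ⟨g x, x, rfl⟩ := by
    have hx : f.quotKerEquivRange.symm ⟨f x, x, rfl⟩ = Submodule.Quotient.mk x := by
      rw [LinearEquiv.symm_apply_eq]
      rfl
    simp only [k, LinearEquiv.trans_apply, hx]
    rfl
  simpa [hk] using he ⟨f x, x, rfl⟩

end Subspaces

section Counting

open scoped Classical

/-- Weighted counts below every member of two families determine the families up to order. -/
theorem exists_perm_of_sum_le_eq {ι P : Type*} [Fintype ι] [PartialOrder P] [Finite P]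
    (s : P → ℂ) (hs : ∀ p, s p ≠ 0) (K L : ι → P)
    (h : ∀ p, (p ∈ Set.range K ∨ p ∈ Set.range L) →
      ∑ i, (if K i ≤ p then s (K i) else 0) = ∑ i, (if L i ≤ p then s (L i) else 0)) :
    ∃ π : Equiv.Perm ι, ∀ i, L i = K (π i) := by
  have := Fintype.ofFinite P
  have hsplit : ∀ (M : ι → P) (p : P), ∑ i, (if M i ≤ p then s (M i) else 0) =
      ∑ r ∈ Finset.univ.filter (· < p), Fintype.card {i // M i = r} * s r +
        Fintype.card {i // M i = p} * s p := by
    intro M p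
    have hfib : ∀ r, (Fintype.card {i // M i = r} : ℂ) * s r =
        ∑ i, if M i = r then s (M i) else 0 := by
      intro r
      rw [Fintype.card_subtype, ← nsmul_eq_mul, ← Finset.sum_const, Finset.sum_filter]
      exact Finset.sum_congr rfl fun i _ => by split_ifs with hi <;> simp [hi]
    simp only [hfib]
    rw [Finset.sum_comm, ← Finset.sum_add_distrib]
    refine Finset.sum_congr rfl fun i _ => ?_
    simp only [Finset.sum_ite_eq, Finset.mem_filter_univ, le_iff_lt_or_eq]
    by_cases h1 : M i = p
    · simp [h1]
    · simp [h1]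
  have hcard : ∀ p, Fintype.card {i // K i = p} = Fintype.card {i // L i = p} := by
    intro p
    induction p using WellFoundedLT.induction with
    | ind p ih =>
      by_cases hp : p ∈ Set.range K ∨ p ∈ Set.range L
      · have hsum := h p hp
        rw [hsplit, hsplit, Finset.sum_congr rfl fun r hr => by
          rw [ih r (Finset.mem_filter.1 hr).2]] at hsum
        exact_mod_cast mul_right_cancel₀ (hs p) (add_left_cancel hsum)
      · simp only [Set.mem_range, not_or, not_exists] at hp
        simp [hp.1, hp.2]
  let e : ι ≃ ι := (Equiv.sigmaFiberEquiv L).symm.trans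
    ((Equiv.sigmaCongrRight fun p => (Fintype.equivOfCardEq (hcard p)).symm).trans
      (Equiv.sigmaFiberEquiv K))
  refine ⟨e, fun i => ?_⟩
  exact ((Fintype.equivOfCardEq (hcard (L i))).symm ⟨i, rfl⟩).2.symm

end Counting

section MatrixModules

open scoped Classical

variable {F C ι : Type*} [Field F] {n : ℕ} [AddCommGroup C] [Module (Matrix (Fin n) (Fin n) F) C]

theorem exists_trace_mul_eq {A : Matrix (Fin n) (Fin n) F} (hA : A ≠ 0) (x : F) :
    ∃ B : Matrix (Fin n) (Fin n) F, (B * A).trace = x := by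
  obtain ⟨i, j, hij⟩ : ∃ i j, A i j ≠ 0 := by
    by_contra! h
    exact hA (Matrix.ext h)
  refine ⟨Matrix.single j i (x / A i j), ?_⟩
  rw [Matrix.trace_single_mul]
  simp [hij]

/-- The orthogonality relation for the character `ψ ∘ trace ∘ g` summed over `ker f`. -/
theorem sum_ker_addChar_trace [Fintype C] (ψ : AddChar F ℂ) {x : F} (hx : ψ x ≠ 1)
    (f g : C →ₗ[Matrix (Fin n) (Fin n) F] Matrix (Fin n) (Fin n) F) :
    ∑ c, (if f c = 0 then ψ (g c).trace else 0) =
      if LinearMap.ker f ≤ LinearMap.ker g then (Fintype.card (LinearMap.ker f) : ℂ) else 0 := by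
  let χ : AddChar (LinearMap.ker f) ℂ := ψ.compAddMonoidHom
    ((Matrix.traceAddMonoidHom (Fin n) F).comp
      (g.toAddMonoidHom.comp (LinearMap.ker f).subtype.toAddMonoidHom))
  have hχ : ∀ c, χ c = ψ (g c).trace := fun c => rfl
  have htriv : χ = 0 ↔ LinearMap.ker f ≤ LinearMap.ker g := by
    constructor
    · intro h c hc
      by_contra hgc
      obtain ⟨B, hB⟩ := exists_trace_mul_eq (A := g c) hgc x
      have := hχ ⟨B • c, (LinearMap.ker f).smul_mem B hc⟩
      rw [h] at this
      simp only [map_smul, smul_eq_mul, hB] at this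
      exact hx (by simpa using this.symm)
    · intro h
      ext c
      have : g c = 0 := h c.2
      simp [hχ, this]
  rw [← Finset.sum_filter]
  simp only [← htriv]
  rw [← AddChar.sum_eq_ite χ]
  simp only [hχ]
  exact Finset.sum_subtype _ (by simp) _

theorem exists_perm_ker_eq [Fintype F] [Fintype C] [Fintype ι]
    (f g : ι → C →ₗ[Matrix (Fin n) (Fin n) F] Matrix (Fin n) (Fin n) F)
    (h : ∀ c, ∑ i, (if f i c = 0 then (1 : ℚ) else 0) = ∑ i, (if g i c = 0 then (1 : ℚ) else 0)) :
    ∃ π : Equiv.Perm ι, ∀ i, LinearMap.ker (g i) = LinearMap.ker (f (π i)) := by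
  obtain ⟨ψ, hψ⟩ := AddChar.exists_apply_ne_zero.2 (one_ne_zero (α := F))
  have hsum : ∀ e : C →ₗ[Matrix (Fin n) (Fin n) F] Matrix (Fin n) (Fin n) F,
      ∑ i, (if LinearMap.ker (f i) ≤ LinearMap.ker e
          then (Fintype.card (LinearMap.ker (f i)) : ℂ) else 0) =
        ∑ i, (if LinearMap.ker (g i) ≤ LinearMap.ker e
          then (Fintype.card (LinearMap.ker (g i)) : ℂ) else 0) := by
    intro e
    simp only [← sum_ker_addChar_trace ψ hψ]
    rw [Finset.sum_comm, Finset.sum_comm (s := (Finset.univ : Finset ι))]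
    refine Finset.sum_congr rfl fun c _ => ?_
    have hc := congrArg (fun r : ℚ => ψ (e c).trace * (r : ℂ)) (h c)
    simpa only [Rat.cast_sum, Finset.mul_sum, apply_ite ((↑) : ℚ → ℂ), Rat.cast_one, Rat.cast_zero,
      mul_ite, mul_one, mul_zero] using hc
  refine exists_perm_of_sum_le_eq
    (fun K : Submodule (Matrix (Fin n) (Fin n) F) C => (Fintype.card K : ℂ))
    (fun K => Nat.cast_ne_zero.2 Fintype.card_ne_zero) (fun i => LinearMap.ker (f i))
    (fun i => LinearMap.ker (g i)) ?_
  rintro _ (⟨j, rfl⟩ | ⟨j, rfl⟩)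
  · exact hsum (f j)
  · exact hsum (g j)

theorem exists_unit_of_ker_eq [Module F C] [IsScalarTower F (Matrix (Fin n) (Fin n) F) C]
    (hn : 1 ≤ n) (f g : C →ₗ[Matrix (Fin n) (Fin n) F] Matrix (Fin n) (Fin n) F)
    (h : LinearMap.ker f = LinearMap.ker g) :
    ∃ u : (Matrix (Fin n) (Fin n) F)ˣ, ∀ c, g c = f c * (u : Matrix (Fin n) (Fin n) F) := by
  let o : Fin n := ⟨0, hn⟩
  let row : (C →ₗ[Matrix (Fin n) (Fin n) F] Matrix (Fin n) (Fin n) F) → C →ₗ[F] Fin n → F :=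
    fun e => LinearMap.proj (φ := fun _ : Fin n => Fin n → F) o ∘ₗ e.restrictScalars F
  have hrow : ∀ e c, row e c = e c o := fun e c => rfl
  have hsingle : ∀ (e : C →ₗ[Matrix (Fin n) (Fin n) F] Matrix (Fin n) (Fin n) F) (i : Fin n) c,
      e (Matrix.single o i (1 : F) • c) o = e c i := by
    intro e i c
    ext j
    simp
  have hker : ∀ e c, c ∈ LinearMap.ker (row e) ↔
      Matrix.single o o (1 : F) • c ∈ LinearMap.ker e := by
    intro e c
    rw [LinearMap.mem_ker, LinearMap.mem_ker, hrow]
    constructor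
    · intro hc
      ext i j
      by_cases hi : i = o
      · subst hi
        rw [hsingle, hc]; rfl
      · simp [Matrix.single_mul_apply_of_ne _ _ _ _ _ hi]
    · intro hc
      rw [← hsingle, hc]; rfl
  obtain ⟨e, he⟩ := exists_linearEquiv_comp_eq_of_ker_eq (row f) (row g)
    (by ext c; rw [hker, hker, h])
  have hmul : ∀ k l : (Fin n → F) →ₗ[F] Fin n → F, k ∘ₗ l = LinearMap.id →
      l.toMatrixRight' * k.toMatrixRight' = 1 := by
    intro k l hkl
    rw [← LinearMap.toMatrixRight'_comp, hkl, LinearMap.toMatrixRight'_id]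
  refine ⟨⟨(e : (Fin n → F) →ₗ[F] Fin n → F).toMatrixRight',
    (e.symm : (Fin n → F) →ₗ[F] Fin n → F).toMatrixRight',
    hmul _ _ (by ext; simp), hmul _ _ (by ext; simp)⟩, fun c => ?_⟩
  funext i
  have hi := he (Matrix.single o i (1 : F) • c)
  rw [hrow, hrow, hsingle, hsingle] at hi
  rw [hi, Matrix.mul_apply_eq_vecMul, ← Matrix.toLinearMapRight'_apply]
  simp

theorem exists_matrix_rank_mul_eq_finrank_map (B : Submodule F (Fin n → F)) :
    ∃ A : Matrix (Fin n) (Fin n) F, ∀ P : Matrix (Fin n) (Fin n) F,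
      (A * P).rank = Module.finrank F (B.map P.vecMulLinear) := by
  obtain ⟨p, hp⟩ := LinearMap.exists_leftInverse_of_injective B.subtype
    (LinearMap.ker_eq_bot.2 B.injective_subtype)
  refine ⟨(B.subtype ∘ₗ p).toMatrixRight', fun P => ?_⟩
  have hrange : LinearMap.range (B.subtype ∘ₗ p) = B := by
    have hsurj : Function.Surjective p := fun b => ⟨b, by simpa using LinearMap.congr_fun hp b⟩
    rw [LinearMap.range_comp, LinearMap.range_eq_top.2 hsurj, Submodule.map_top,
      Submodule.range_subtype]
  have hcomp : (LinearMap.toMatrixRight' (B.subtype ∘ₗ p) * P).vecMulLinear =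
      P.vecMulLinear ∘ₗ B.subtype ∘ₗ p := by
    refine LinearMap.ext fun v => ?_
    have hv : Matrix.vecMul v (LinearMap.toMatrixRight' (B.subtype ∘ₗ p)) = p v := by
      rw [← Matrix.toLinearMapRight'_apply]
      simp
    rw [Matrix.vecMulLinear_apply, ← Matrix.vecMul_vecMul, hv]
    rfl
  rw [Matrix.rank_eq_finrank_span_row, ← range_vecMulLinear, hcomp, LinearMap.range_comp, hrange]

theorem sum_indicator_eq_zero_eq_of_sum_rank_mul [Fintype F] [Fintype ι]
    (P Q : ι → Matrix (Fin n) (Fin n) F)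
    (h : ∀ A : Matrix (Fin n) (Fin n) F,
      ∑ i, ((A * P i).rank : ℚ) = ∑ i, ((A * Q i).rank : ℚ)) :
    ∑ i, (if P i = 0 then (1 : ℚ) else 0) = ∑ i, (if Q i = 0 then (1 : ℚ) else 0) := by
  have hzero : ∀ A : Matrix (Fin n) (Fin n) F, A.vecMulLinear = 0 ↔ A = 0 := by
    refine fun A => ⟨fun hA => ?_, fun hA => ?_⟩
    · exact Matrix.ext_of_single_vecMul fun i => by simpa using LinearMap.congr_fun hA (Pi.single i 1)
    · exact LinearMap.ext fun v => by simp [hA]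
  have hcount := sum_indicator_eq_zero_eq_of_sum_finrank_map (fun i => (P i).vecMulLinear)
    (fun i => (Q i).vecMulLinear) fun B => by
      obtain ⟨A, hA⟩ := exists_matrix_rank_mul_eq_finrank_map B
      simpa only [hA] using h A
  simpa only [hzero] using hcount

end MatrixModules

/-- on `R = Matₙ(F)`, `F` a finite field and `n ≥ 1`, the rank
weight `w(A) = rank A` is bi-invariant and `(R, w)` satisfies the Extension
Property. -/
theorem stmt17 (F : Type) [Field F] [Fintype F] (n : ℕ) (hn : 1 ≤ n)
    (w : Matrix (Fin n) (Fin n) F → ℚ)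
    (hw : ∀ A : Matrix (Fin n) (Fin n) F, w A = (A.rank : ℚ)) :
    (∀ (U : (Matrix (Fin n) (Fin n) F)ˣ) (A : Matrix (Fin n) (Fin n) F),
      w ((U : Matrix (Fin n) (Fin n) F) * A) = w A ∧
      w (A * (U : Matrix (Fin n) (Fin n) F)) = w A) ∧
    ExtensionProperty (Matrix (Fin n) (Fin n) F) w := by
  have hdet : ∀ U : (Matrix (Fin n) (Fin n) F)ˣ, IsUnit (U : Matrix (Fin n) (Fin n) F).det :=
    fun U => (Matrix.isUnit_iff_isUnit_det _).1 U.isUnit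
  have hright : ∀ (U : (Matrix (Fin n) (Fin n) F)ˣ) (A : Matrix (Fin n) (Fin n) F),
      w (A * (U : Matrix (Fin n) (Fin n) F)) = w A := fun U A => by
    rw [hw, hw, Matrix.rank_mul_eq_left_of_isUnit_det _ _ (hdet U)]
  refine ⟨fun U A => ⟨?_, hright U A⟩, fun m C φ _ hφ => ?_⟩
  · rw [hw, hw, Matrix.rank_mul_eq_right_of_isUnit_det _ _ (hdet U)]
  have : Fintype C := Fintype.ofFinite C
  let f : Fin m → C →ₗ[Matrix (Fin n) (Fin n) F] Matrix (Fin n) (Fin n) F :=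
    fun i => LinearMap.proj i ∘ₗ C.subtype
  let g : Fin m → C →ₗ[Matrix (Fin n) (Fin n) F] Matrix (Fin n) (Fin n) F :=
    fun i => LinearMap.proj i ∘ₗ φ
  obtain ⟨π, hπ⟩ := exists_perm_ker_eq f g fun c => by
    refine sum_indicator_eq_zero_eq_of_sum_rank_mul _ _ fun A => ?_
    simpa [hw, f, g] using (hφ (A • c)).symm
  choose u hu using fun i => exists_unit_of_ker_eq hn (f (π i)) (g i) (hπ i).symm
  exact ⟨π, u, fun i => hright (u i), fun c i => hu i c⟩
end
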